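/- arXiv:2407.04497 — 5 statements merged into one kernel-verified Lean document; each statement's English description precedes it below -/
import Mathlib

section
/- Let (B, M) be a reduced quasi-excellent local (Noetherian) ring containing the rational numbers such that B/M is uncountable and |B| = |B/M|, and suppose Min(B) is partitioned into m ≥ 1 subcollections C₁, …, C_m. Then there exists a reduced QUASI-EXCELLENT local subring S ⊆ B with maximal ideal S ∩ M satisfying: (1) S contains the rationals; (2) the completion of S equals the completion of B; (3) S/(S ∩ M) is uncountable and |S| = |S/(S ∩ M)|; (4) for Q, Q′ ∈ Min(B), Q ∩ S = Q′ ∩ S if and only if Q and Q′ lie in the same subcollection Cᵢ; (5) the map f : Spec(B) → Spec(S) given by f(P) = S ∩ P is onto, and if P has positive height then f(P)B = P. -/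
/-!
Theorem 2.14 of [Gluing2021] combined with Proposition 3.6 of [UFDSpecs]: gluing
minimal primes of a reduced quasi-excellent local ring, obtaining a quasi-excellent
subring.

Conventions: a "local ring" is a commutative Noetherian ring with exactly one maximal
ideal.  "The completion of `S` equals the completion of `B`" is formalized as: there is
a ring isomorphism between the two maximal-ideal-adic completions that is compatible
with the inclusion `S ⊆ B`.  Quasi-excellence is defined below (Noetherian + G-ring +
J-2, with geometric regularity of formal fibers spelled out via residue fields and
finite field extensions).
-/

universe u

open IsLocalRing

/-- A commutative ring is a *regular local ring* if it is Noetherian, local, and its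
maximal ideal can be generated by `d` elements, where `d` is its Krull dimension. -/
def IsRegularLocalRingOld (A : Type u) [CommRing A] : Prop :=
  ∃ h : IsLocalRing A,
    letI := h
    IsNoetherianRing A ∧
      ∃ s : Finset A, Ideal.span (s : Set A) = IsLocalRing.maximalIdeal A ∧
        (s.card : WithBot (WithTop ℕ)) = ringKrullDim A

/-- A commutative ring is *regular* if it is Noetherian and all of its localizations at
primes are regular local rings. -/
def IsRegularRingOld (A : Type u) [CommRing A] : Prop :=
  IsNoetherianRing A ∧
    ∀ (p : Ideal A) (hp : p.IsPrime),
      letI := hp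
      IsRegularLocalRingOld (Localization.AtPrime p)

/-- An algebra `A` over a field `k` is *geometrically regular* if `L ⊗[k] A` is a
regular ring for every finite field extension `L` of `k`. -/
def Algebra.IsGeometricallyRegular (k : Type u) (A : Type u) [Field k] [CommRing A]
    [Algebra k A] : Prop :=
  ∀ (L : Type u) [Field L] [Algebra k L] [Module.Finite k L],
    IsRegularRingOld (TensorProduct k L A)

/-- An algebra `S` over `R` has *geometrically regular fibers* if for every prime `p`
of `R` the fiber ring `κ(p) ⊗[R] S` is geometrically regular over the residue field
`κ(p)`. -/
def Algebra.HasGeometricallyRegularFibers (R S : Type u) [CommRing R] [CommRing S]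
    [Algebra R S] : Prop :=
  ∀ (p : Ideal R) (hp : p.IsPrime),
    letI := hp
    Algebra.IsGeometricallyRegular (IsLocalRing.ResidueField (Localization.AtPrime p))
      (TensorProduct R (IsLocalRing.ResidueField (Localization.AtPrime p)) S)

/-- A (Noetherian) commutative ring is a *G-ring* if, for every prime `q`, the formal
fibers of the local ring `A_q` (i.e. the fibers of the map from `A_q` to its
maximal-ideal-adic completion) are geometrically regular. -/
def IsGRing (A : Type u) [CommRing A] : Prop :=
  ∀ (q : Ideal A) (hq : q.IsPrime),
    letI := hq
    Algebra.HasGeometricallyRegularFibers (Localization.AtPrime q)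
      (AdicCompletion (IsLocalRing.maximalIdeal (Localization.AtPrime q))
        (Localization.AtPrime q))

/-- A commutative ring `A` is *J-2* if the regular locus of every finitely generated
`A`-algebra is open in its prime spectrum. -/
def IsJ2Ring (A : Type u) [CommRing A] : Prop :=
  ∀ (C : Type u) [CommRing C] [Algebra A C], Algebra.FiniteType A C →
    IsOpen {p : PrimeSpectrum C | IsRegularLocalRingOld (Localization.AtPrime p.asIdeal)}

/-- A commutative ring is *quasi-excellent* if it is Noetherian, a G-ring, and J-2. -/
def IsQuasiExcellentRing (A : Type u) [CommRing A] : Prop :=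
  IsNoetherianRing A ∧ IsGRing A ∧ IsJ2Ring A

open TensorProduct

theorem isRegularLocalRingOld_iff (A : Type u) [CommRing A] :
    IsRegularLocalRingOld A ↔ IsRegularLocalRing A := by
  constructor
  · rintro ⟨h, hN, s, hs, hc⟩
    refine IsRegularLocalRing.of_spanFinrank_maximalIdeal_le A ?_
    rw [← hc, ← hs]
    have := Submodule.spanFinrank_span_le_ncard_of_finite (R := A) (s := (s : Set A))
      s.finite_toSet
    rw [Set.ncard_coe_finset] at this
    exact WithBot.coe_le_coe.mpr (Nat.cast_le.mpr this)
  · intro h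
    refine ⟨h.toIsLocalRing, inferInstance, ?_⟩
    obtain ⟨s, hs, hs'⟩ := Submodule.FG.exists_span_finset_card_eq_spanFinrank
      (IsNoetherian.noetherian (maximalIdeal A))
    refine ⟨s, hs', ?_⟩
    rw [hs]
    exact h.spanFinrank_maximalIdeal

theorem isRegularRingOld_iff (A : Type u) [CommRing A] :
    IsRegularRingOld A ↔ IsRegularRing A := by
  constructor
  · rintro ⟨h, h'⟩
    exact isRegularRing_iff.mpr fun p hp => (isRegularLocalRingOld_iff _).mp (h' p hp)
  · intro h
    exact ⟨inferInstance, fun p hp => (isRegularLocalRingOld_iff _).mpr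
      (h.isRegularLocalRing_localization p)⟩

theorem IsRegularRing.of_subsingleton (A : Type*) [CommRing A] [Subsingleton A] :
    IsRegularRing A :=
  isRegularRing_iff.mpr fun _ hp => (hp.ne_top (Subsingleton.elim _ _)).elim

theorem IsRegularRing.pi {ι : Type*} [Finite ι] (A : ι → Type*) [∀ i, CommRing (A i)]
    [∀ i, IsRegularRing (A i)] : IsRegularRing (∀ i, A i) := by
  have : ∀ i, IsNoetherianRing (A i) := fun i => inferInstance
  refine isRegularRing_iff.mpr fun p hp => ?_
  obtain ⟨⟨i, q⟩, hq⟩ := (PrimeSpectrum.sigmaToPi_bijective A).2 ⟨p, hp⟩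
  have hq' : q.asIdeal.comap (Pi.evalRingHom A i) = p := congrArg PrimeSpectrum.asIdeal hq
  subst hq'
  exact IsRegularLocalRing.of_ringEquiv
    (RingEquiv.ofBijective _ (Localization.AtPrime.mapPiEvalRingHom_bijective q.asIdeal)).symm

theorem IsRegularRing.of_isLocalization {R : Type*} [CommRing R] [IsRegularRing R]
    (M : Submonoid R) (R' : Type*) [CommRing R'] [Algebra R R'] [IsLocalization M R'] :
    IsRegularRing R' := by
  have := IsLocalization.isNoetherianRing M R' inferInstance
  refine isRegularRing_iff.mpr fun p hp => ?_
  have : IsLocalization.AtPrime (Localization.AtPrime p) (p.comap (algebraMap R R')) :=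
    IsLocalization.isLocalization_isLocalization_atPrime_isLocalization M _ p
  exact IsRegularLocalRing.of_ringEquiv
    (IsLocalization.algEquiv (p.comap (algebraMap R R')).primeCompl
      (Localization.AtPrime (p.comap (algebraMap R R'))) (Localization.AtPrime p)).toRingEquiv

section LocalFlat

variable {A A' : Type*} [CommRing A] [CommRing A'] [IsLocalRing A] [IsLocalRing A']
  [IsNoetherianRing A] [IsNoetherianRing A'] [Algebra A A'] [IsLocalHom (algebraMap A A')]
  [Module.Flat A A']

theorem map_maximalIdeal_le_maximalIdeal :
    (maximalIdeal A).map (algebraMap A A') ≤ maximalIdeal A' :=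
  ((IsLocalRing.local_hom_TFAE (algebraMap A A')).out 0 2 rfl rfl).mp inferInstance

theorem nontrivial_quotient_map_maximalIdeal :
    Nontrivial (A' ⧸ (maximalIdeal A).map (algebraMap A A')) :=
  Ideal.Quotient.nontrivial_iff.mpr
    (ne_top_of_le_ne_top Ideal.IsPrime.ne_top' map_maximalIdeal_le_maximalIdeal)

theorem isLocalRing_quotient_map_maximalIdeal :
    IsLocalRing (A' ⧸ (maximalIdeal A).map (algebraMap A A')) :=
  have := nontrivial_quotient_map_maximalIdeal (A := A) (A' := A')
  .of_surjective' (Ideal.Quotient.mk _) Ideal.Quotient.mk_surjective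

theorem map_maximalIdeal_quotient [IsLocalRing (A' ⧸ (maximalIdeal A).map (algebraMap A A'))] :
    (maximalIdeal A').map (Ideal.Quotient.mk ((maximalIdeal A).map (algebraMap A A'))) =
      maximalIdeal _ := by
  refine IsLocalRing.eq_maximalIdeal ?_
  refine .map_of_surjective_of_ker_le Ideal.Quotient.mk_surjective ?_
  rw [Ideal.mk_ker]
  exact map_maximalIdeal_le_maximalIdeal

theorem ringKrullDim_eq_add_of_flat :
    ringKrullDim A' = ringKrullDim A +
      ringKrullDim (A' ⧸ (maximalIdeal A).map (algebraMap A A')) := by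
  have := isLocalRing_quotient_map_maximalIdeal (A := A) (A' := A')
  have : (maximalIdeal A').LiesOver (maximalIdeal A) :=
    ⟨(((IsLocalRing.local_hom_TFAE (algebraMap A A')).out 0 4 rfl rfl).mp inferInstance).symm⟩
  have h := Ideal.height_eq_height_add_of_liesOver_of_hasGoingDown (maximalIdeal A)
    (maximalIdeal A')
  rw [map_maximalIdeal_quotient] at h
  rw [← IsLocalRing.maximalIdeal_height_eq_ringKrullDim,
    ← IsLocalRing.maximalIdeal_height_eq_ringKrullDim,
    ← IsLocalRing.maximalIdeal_height_eq_ringKrullDim, h]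
  rfl

/-- A flat local extension of a regular local ring with regular closed fibre is regular. -/
theorem IsRegularLocalRing.of_flat_of_isRegularLocalRing_quotient [IsRegularLocalRing A]
    [IsRegularLocalRing (A' ⧸ (maximalIdeal A).map (algebraMap A A'))] :
    IsRegularLocalRing A' := by
  refine IsRegularLocalRing.of_spanFinrank_maximalIdeal_le A' ?_
  rw [ringKrullDim_eq_add_of_flat (A := A), ← IsRegularLocalRing.spanFinrank_maximalIdeal,
    ← IsRegularLocalRing.spanFinrank_maximalIdeal]
  set I := (maximalIdeal A).map (algebraMap A A') with hI
  obtain ⟨s, hs, hs'⟩ := Submodule.FG.exists_span_finset_card_eq_spanFinrank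
      (IsNoetherian.noetherian (maximalIdeal A))
  obtain ⟨t, ht, ht'⟩ := Submodule.FG.exists_span_finset_card_eq_spanFinrank
      (IsNoetherian.noetherian (maximalIdeal (A' ⧸ I)))
  classical
  let g : A' ⧸ I → A' := Function.surjInv Ideal.Quotient.mk_surjective
  have hg : ∀ x, Ideal.Quotient.mk I (g x) = x := Function.surjInv_eq _
  have key : Ideal.span ((s.image (algebraMap A A') ∪ t.image g : Finset A') : Set A') =
      maximalIdeal A' := by
    rw [Finset.coe_union, Ideal.span_union, Finset.coe_image, Finset.coe_image,
      ← Ideal.map_span]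
    change Ideal.map _ (Submodule.span A s) ⊔ _ = _
    rw [hs', ← hI]
    have h1 : (maximalIdeal A').map (Ideal.Quotient.mk I) =
        (Ideal.span (g '' t)).map (Ideal.Quotient.mk I) := by
      rw [map_maximalIdeal_quotient, Ideal.map_span, Set.image_image]
      simp only [hg, Set.image_id']
      exact ht'.symm
    have h2 := congrArg (Ideal.comap (Ideal.Quotient.mk I)) h1
    rw [Ideal.comap_map_of_surjective _ Ideal.Quotient.mk_surjective,
      Ideal.comap_map_of_surjective _ Ideal.Quotient.mk_surjective, ← RingHom.ker_eq_comap_bot,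
      Ideal.mk_ker, sup_eq_left.mpr map_maximalIdeal_le_maximalIdeal] at h2
    rw [h2, sup_comm]
  rw [← key]
  have := Submodule.spanFinrank_span_le_ncard_of_finite (R := A')
    (s := ((s.image (algebraMap A A') ∪ t.image g : Finset A') : Set A')) (Finset.finite_toSet _)
  rw [Set.ncard_coe_finset] at this
  have h3 : (s.image (algebraMap A A') ∪ t.image g).card ≤ s.card + t.card :=
    (Finset.card_union_le _ _).trans (add_le_add Finset.card_image_le Finset.card_image_le)
  rw [← hs, ← ht]
  exact_mod_cast this.trans h3

/-- Regularity descends along flat local homomorphisms whose closed fibre is a field. -/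
theorem IsRegularLocalRing.of_flat_of_map_maximalIdeal [IsRegularLocalRing A']
    (h : (maximalIdeal A).map (algebraMap A A') = maximalIdeal A') :
    IsRegularLocalRing A := by
  refine IsRegularLocalRing.of_spanFinrank_maximalIdeal_le A ?_
  have hdim : ringKrullDim A' = ringKrullDim A := by
    rw [ringKrullDim_eq_add_of_flat (A := A), h]
    let := Ideal.Quotient.field (maximalIdeal A')
    rw [ringKrullDim_eq_zero_of_field, add_zero]
  rw [← hdim, ← IsRegularLocalRing.spanFinrank_maximalIdeal,
    spanFinrank_maximalIdeal_eq_finrank_cotangentSpace (R := A')]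
  have hmem : ∀ x : maximalIdeal A, algebraMap A A' x ∈ maximalIdeal A' := fun x =>
    h ▸ Ideal.mem_map_of_mem _ x.2
  let φ : maximalIdeal A → CotangentSpace A' := fun x =>
    (maximalIdeal A').toCotangent ⟨algebraMap A A' x, hmem x⟩
  let ψ : maximalIdeal A → maximalIdeal A' := fun x => ⟨algebraMap A A' x, hmem x⟩
  have hspan (T : Set (maximalIdeal A)) : Submodule.span A' (ψ '' T) = ⊤ ↔
      (Ideal.span (Subtype.val '' T)).map (algebraMap A A') = maximalIdeal A' := by
    have hinj := Submodule.map_injective_of_injective (maximalIdeal A').subtype_injective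
    rw [← hinj.eq_iff, Submodule.map_span, Submodule.map_top, Submodule.range_subtype,
      Ideal.map_span, ← Set.image_comp, ← Set.image_comp]
    rfl
  have hT : Submodule.span (ResidueField A') (Set.range φ) = ⊤ := by
    have := (CotangentSpace.span_image_eq_top_iff (R := A') (s := Set.range ψ)).mpr (by
      rw [← Set.image_univ, hspan, Set.image_univ, Subtype.range_coe]
      erw [Ideal.span_eq, h])
    rw [← Set.range_comp] at this
    exact this
  obtain ⟨b, hb, hb', hli⟩ := exists_linearIndependent (ResidueField A') (Set.range φ)
  rw [hT] at hb'
  obtain ⟨T, rfl, hTi⟩ : ∃ T : Set (maximalIdeal A), φ '' T = b ∧ Set.InjOn φ T := by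
    obtain ⟨T, hT1, hT2⟩ := Set.exists_image_eq_and_injOn (φ ⁻¹' b) φ
    exact ⟨T, hT1.trans (Set.image_preimage_eq_of_subset hb), hT2⟩
  have hfin : (φ '' T).Finite := hli.setFinite
  have hcard : T.ncard = Module.finrank (ResidueField A') (CotangentSpace A') := by
    rw [← hTi.ncard_image]
    exact (Module.finrank_eq_nat_card_basis
      (Module.Basis.mk hli (by rw [Subtype.range_coe, hb']))).symm
  have hTfin : T.Finite := Set.Finite.of_finite_image hfin hTi
  have hb'' : Submodule.span A' (ψ '' T) = ⊤ := by
    refine (CotangentSpace.span_image_eq_top_iff (R := A') (s := ψ '' T)).mp ?_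
    rw [← Set.image_comp]
    exact hb'
  rw [hspan, ← h] at hb''
  have : Module.FaithfullyFlat A A' := Module.FaithfullyFlat.of_flat_of_isLocalHom
  have h5 := congrArg (Ideal.comap (algebraMap A A')) hb''
  rw [Ideal.comap_map_eq_self_of_faithfullyFlat, Ideal.comap_map_eq_self_of_faithfullyFlat] at h5
  rw [← h5, ← hcard]
  refine WithBot.coe_le_coe.mpr (Nat.cast_le.mpr ?_)
  refine (Submodule.spanFinrank_span_le_ncard_of_finite (R := A) (hTfin.image _)).trans ?_
  exact Set.ncard_image_le hTfin

end LocalFlat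

theorem IsRegularLocalRing.localization_congr {R : Type*} [CommRing R] {I J : Ideal R}
    [I.IsPrime] [J.IsPrime] (h : I = J) (hI : IsRegularLocalRing (Localization.AtPrime I)) :
    IsRegularLocalRing (Localization.AtPrime J) := by
  subst h
  exact hI

theorem IsRegularLocalRing.isField_of_ringKrullDim_eq_zero {A : Type*} [CommRing A]
    [IsRegularLocalRing A] (h : ringKrullDim A = 0) : IsField A := by
  have h1 := IsRegularLocalRing.spanFinrank_maximalIdeal (R := A)
  rw [h] at h1
  have h2 : (maximalIdeal A).spanFinrank = 0 := by exact_mod_cast h1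
  rw [IsLocalRing.isField_iff_maximalIdeal_eq]
  exact (Submodule.spanFinrank_eq_zero_iff_eq_bot (IsNoetherian.noetherian _)).mp h2

section GlobalFlat

variable {R R' : Type*} [CommRing R] [CommRing R'] [Algebra R R']
  [IsNoetherianRing R] [IsNoetherianRing R'] [Module.Flat R R']

theorem isRegularLocalRing_localization_of_fiber (p : Ideal R) [p.IsPrime]
    (q : Ideal (p.Fiber R')) [q.IsPrime] [IsRegularLocalRing (Localization.AtPrime p)]
    [IsRegularLocalRing (Localization.AtPrime q)] :
    IsRegularLocalRing (Localization.AtPrime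
      (q.comap (Algebra.TensorProduct.includeRight : R' →ₐ[R] p.Fiber R'))) := by
  let r := q.comap (Algebra.TensorProduct.includeRight : R' →ₐ[R] p.Fiber R')
  have : r.LiesOver p := ((PrimeSpectrum.primesOverOrderIsoFiber R R' p).symm ⟨q, ‹_›⟩).2.2
  let := Localization.AtPrime.algebraOfLiesOver p r
  have e : Localization.AtPrime q ≃ₐ[Localization.AtPrime p]
      Localization.AtPrime r ⧸ p.map (algebraMap R (Localization.AtPrime r)) :=
    Ideal.Fiber.localizationAlgEquivQuotient p q
  have h : p.map (algebraMap R (Localization.AtPrime r)) =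
      (maximalIdeal (Localization.AtPrime p)).map
        (algebraMap (Localization.AtPrime p) (Localization.AtPrime r)) := by
    rw [← Localization.AtPrime.map_eq_maximalIdeal, Ideal.map_map,
      ← IsScalarTower.algebraMap_eq]
  rw [h] at e
  have := IsRegularLocalRing.of_ringEquiv (R := Localization.AtPrime q) e.toRingEquiv
  exact IsRegularLocalRing.of_flat_of_isRegularLocalRing_quotient
    (A := Localization.AtPrime p) (A' := Localization.AtPrime r)

theorem isRegularLocalRing_localization_of_fiber_of_height_eq_zero (p : Ideal R) [p.IsPrime]
    (q : Ideal (p.Fiber R')) [q.IsPrime] (hq : q ∈ minimalPrimes (p.Fiber R'))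
    [IsRegularLocalRing (Localization.AtPrime q)]
    [IsRegularLocalRing (Localization.AtPrime
      (q.comap (Algebra.TensorProduct.includeRight : R' →ₐ[R] p.Fiber R')))] :
    IsRegularLocalRing (Localization.AtPrime p) := by
  let r := q.comap (Algebra.TensorProduct.includeRight : R' →ₐ[R] p.Fiber R')
  have : r.LiesOver p := ((PrimeSpectrum.primesOverOrderIsoFiber R R' p).symm ⟨q, ‹_›⟩).2.2
  let := Localization.AtPrime.algebraOfLiesOver p r
  have e : Localization.AtPrime q ≃ₐ[Localization.AtPrime p]
      Localization.AtPrime r ⧸ p.map (algebraMap R (Localization.AtPrime r)) :=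
    Ideal.Fiber.localizationAlgEquivQuotient p q
  have h : p.map (algebraMap R (Localization.AtPrime r)) =
      (maximalIdeal (Localization.AtPrime p)).map
        (algebraMap (Localization.AtPrime p) (Localization.AtPrime r)) := by
    rw [← Localization.AtPrime.map_eq_maximalIdeal, Ideal.map_map,
      ← IsScalarTower.algebraMap_eq]
  rw [h] at e
  have : IsRegularLocalRing (Localization.AtPrime r) := ‹_›
  refine IsRegularLocalRing.of_flat_of_map_maximalIdeal (A' := Localization.AtPrime r) ?_
  have hf : IsField (Localization.AtPrime q) :=
    IsRegularLocalRing.isField_of_ringKrullDim_eq_zero (by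
      rw [IsLocalization.AtPrime.ringKrullDim_eq_height q (Localization.AtPrime q),
        Ideal.height_eq_zero_iff.mpr hq]
      rfl)
  have hf' := MulEquiv.isField hf e.symm.toMulEquiv
  exact IsLocalRing.eq_maximalIdeal (Ideal.Quotient.maximal_of_isField _ hf')

/-- The regular locus is compatible with flat maps having regular fibres. -/
theorem regularLocus_preimage_eq
    (hfib : ∀ (p : Ideal R) [p.IsPrime], IsRegularRing (p.Fiber R'))
    (hopen : IsOpen {P : PrimeSpectrum R' | IsRegularLocalRing (Localization.AtPrime P.asIdeal)}) :
    PrimeSpectrum.comap (algebraMap R R') ⁻¹'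
        {p : PrimeSpectrum R | IsRegularLocalRing (Localization.AtPrime p.asIdeal)} =
      {P : PrimeSpectrum R' | IsRegularLocalRing (Localization.AtPrime P.asIdeal)} := by
  ext P
  simp only [Set.mem_preimage, Set.mem_ofPred_eq]
  set p := PrimeSpectrum.comap (algebraMap R R') P with hp
  have hfib' := hfib p.asIdeal
  have hP : P.asIdeal ∈ p.asIdeal.primesOver R' := ⟨P.2, ⟨rfl⟩⟩
  obtain ⟨q, hq⟩ := (PrimeSpectrum.primesOverOrderIsoFiber R R' p.asIdeal).symm.surjective ⟨_, hP⟩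
  have hq' : q.asIdeal.comap Algebra.TensorProduct.includeRight = P.asIdeal :=
    congrArg Subtype.val hq
  constructor
  · intro h
    have := isRegularLocalRing_localization_of_fiber p.asIdeal q.asIdeal
    exact IsRegularLocalRing.localization_congr hq' this
  · intro h
    obtain ⟨q₀, hq₀, hle⟩ := Ideal.exists_minimalPrimes_le (bot_le : ⊥ ≤ q.asIdeal)
    have : q₀.IsPrime := hq₀.1.1
    let r : PrimeSpectrum R' := ⟨q₀.comap Algebra.TensorProduct.includeRight, inferInstance⟩
    have hr : r ⤳ P := by
      rw [← PrimeSpectrum.le_iff_specializes]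
      change q₀.comap _ ≤ _
      rw [← hq']
      exact Ideal.comap_mono hle
    have : IsRegularLocalRing (Localization.AtPrime r.asIdeal) :=
      hopen.stableUnderGeneralization hr h
    exact isRegularLocalRing_localization_of_fiber_of_height_eq_zero p.asIdeal q₀ hq₀

theorem isRegularRing_of_fibers [IsRegularRing R]
    (hfib : ∀ (p : Ideal R) [p.IsPrime], IsRegularRing (p.Fiber R')) : IsRegularRing R' := by
  refine isRegularRing_iff.mpr fun P hP => ?_
  let p := P.under R
  have hfib' := hfib p
  obtain ⟨q, hq⟩ := (PrimeSpectrum.primesOverOrderIsoFiber R R' p).symm.surjective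
    ⟨P, hP, ⟨rfl⟩⟩
  have hq' : q.asIdeal.comap Algebra.TensorProduct.includeRight = P :=
    congrArg Subtype.val hq
  have := isRegularLocalRing_localization_of_fiber p q.asIdeal
  exact IsRegularLocalRing.localization_congr hq' this

theorem isOpen_regularLocus_of_faithfullyFlat [Module.FaithfullyFlat R R']
    (hfib : ∀ (p : Ideal R) [p.IsPrime], IsRegularRing (p.Fiber R'))
    (hopen : IsOpen {P : PrimeSpectrum R' | IsRegularLocalRing (Localization.AtPrime P.asIdeal)}) :
    IsOpen {p : PrimeSpectrum R | IsRegularLocalRing (Localization.AtPrime p.asIdeal)} := by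
  rw [← regularLocus_preimage_eq hfib hopen] at hopen
  have hsurj := PrimeSpectrum.comap_surjective_of_faithfullyFlat (A := R) (B := R')
  have hgen : GeneralizingMap (PrimeSpectrum.comap (algebraMap R R')) :=
    Algebra.HasGoingDown.iff_generalizingMap_primeSpectrumComap.mp inferInstance
  exact (PrimeSpectrum.isQuotientMap_of_generalizingMap hsurj hgen).isOpen_preimage.mp hopen

end GlobalFlat

section GeometricallyRegular

theorem Algebra.FormallyEtale.isRegularRing_of_field (K A : Type u) [Field K] [CommRing A]
    [Algebra K A] [Algebra.EssFiniteType K A] [Algebra.FormallyEtale K A] : IsRegularRing A := by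
  obtain ⟨I, _, Ai, _, _, e, _⟩ := (Algebra.FormallyEtale.iff_exists_algEquiv_prod K A).mp ‹_›
  have := IsRegularRing.pi Ai
  exact IsRegularRing.of_ringEquiv e.symm.toRingEquiv

theorem isRegularRing_tensorProduct_of_finite (E L A : Type u) [Field E] [Field L] [CommRing A]
    [Algebra E L] [Algebra E A] [Module.Finite E L] [Algebra.IsSeparable E L] [IsRegularRing A] :
    IsRegularRing (L ⊗[E] A) := by
  have hN : IsNoetherianRing (A ⊗[E] L) := .of_finite A _
  have := Algebra.FormallyEtale.of_isSeparable E L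
  have : IsRegularRing (A ⊗[E] L) := by
    refine isRegularRing_of_fibers (R := A) fun p hp => ?_
    have e : p.Fiber (A ⊗[E] L) ≃ₐ[p.ResidueField] p.ResidueField ⊗[E] L :=
      Algebra.TensorProduct.cancelBaseChange E A p.ResidueField p.ResidueField L
    have := Algebra.FormallyEtale.isRegularRing_of_field p.ResidueField (p.ResidueField ⊗[E] L)
    exact IsRegularRing.of_ringEquiv e.symm.toRingEquiv
  exact IsRegularRing.of_ringEquiv (Algebra.TensorProduct.comm E A L).toRingEquiv

theorem isRegularRing_tensorProduct_of_isLocalization (K D E A : Type*) [CommRing K]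
    [CommRing D] [CommRing E] [CommRing A] [Algebra K D] [Algebra K E] [Algebra D E]
    [IsScalarTower K D E] [Algebra K A] (M : Submonoid D) [IsLocalization M E]
    [IsRegularRing (D ⊗[K] A)] : IsRegularRing (E ⊗[K] A) := by
  let f : D ⊗[K] A →ₐ[D] E ⊗[K] A := Algebra.TensorProduct.map (Algebra.ofId D E) (AlgHom.id K A)
  let : Algebra (D ⊗[K] A) (E ⊗[K] A) := f.toRingHom.toAlgebra
  have : IsScalarTower D (D ⊗[K] A) (E ⊗[K] A) := .of_algebraMap_eq' f.comp_algebraMap.symm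
  have := IsLocalization.tensorProduct_tensorProduct K A M E (by
    ext a
    change f (1 ⊗ₜ a) = 1 ⊗ₜ a
    simp [f])
  exact IsRegularRing.of_isLocalization (R := D ⊗[K] A)
    (Algebra.algebraMapSubmonoid (D ⊗[K] A) M) _

open IntermediateField.algebraAdjoinAdjoin in
theorem isRegularRing_tensorProduct_adjoin (K L A : Type u) [Field K] [Field L] [CommRing A]
    [Algebra K L] [Algebra K A] {ι : Type*} [Finite ι] (x : ι → L) (hx : AlgebraicIndependent K x)
    [IsRegularRing A] :
    IsRegularRing (IntermediateField.adjoin K (Set.range x) ⊗[K] A) := by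
  let D := Algebra.adjoin K (Set.range x)
  let E := IntermediateField.adjoin K (Set.range x)
  have hD : IsRegularRing (D ⊗[K] A) :=
    IsRegularRing.of_ringEquiv (R := MvPolynomial ι A)
      ((MvPolynomial.algebraTensorAlgEquiv (σ := ι) K A).symm.toRingEquiv.trans
      ((Algebra.TensorProduct.comm K A (MvPolynomial ι K)).toRingEquiv.trans
      (Algebra.TensorProduct.congr hx.aevalEquiv AlgEquiv.refl).toRingEquiv))
  exact isRegularRing_tensorProduct_of_isLocalization K D E A (nonZeroDivisors D)

/-- In characteristic zero, finitely generated field extensions preserve regularity. -/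
theorem isRegularRing_tensorProduct_of_essFiniteType (K L A : Type u) [Field K] [CharZero K]
    [Field L] [CommRing A] [Algebra K L] [Algebra K A] [Algebra.EssFiniteType K L]
    [IsRegularRing A] : IsRegularRing (L ⊗[K] A) := by
  obtain ⟨s, hs⟩ := exists_isTranscendenceBasis K L
  have hfin : Finite s := Cardinal.lt_aleph0_iff_finite.1
    (hs.cardinalMk_eq_trdeg.trans_lt (finTrdeg_iff_trdeg.mp inferInstance))
  let E := IntermediateField.adjoin K (Set.range ((↑) : s → L))
  have h1 : IsRegularRing (E ⊗[K] A) := isRegularRing_tensorProduct_adjoin K L A _ hs.1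
  have halg : Algebra.IsAlgebraic E L := hs.isAlgebraic_field
  have : Algebra.EssFiniteType E L := Algebra.EssFiniteType.of_comp K E L
  have : Module.Finite E L :=
    Algebra.finite_of_essFiniteType_of_isAlgebraic
  have h2 := isRegularRing_tensorProduct_of_finite E L (E ⊗[K] A)
  exact IsRegularRing.of_ringEquiv
    (Algebra.TensorProduct.cancelBaseChange K E E L A).toRingEquiv

end GeometricallyRegular

section Completion

theorem AdicCompletion.factorPow_evalₐ {R : Type*} [CommRing R] (J : Ideal R) {k n : ℕ}
    (h : k ≤ n) (x : AdicCompletion J R) :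
    Ideal.Quotient.factorPow J h (AdicCompletion.evalₐ J n x) = AdicCompletion.evalₐ J k x := by
  induction x using AdicCompletion.induction_on with
  | h x =>
    simp only [AdicCompletion.evalₐ_mk]
    exact Ideal.Quotient.eq.2 (Ideal.Quotient.eq.1 (AdicCompletion.Ideal.mk_eq_mk (I := J) h x))

/-- A ring homomorphism inducing isomorphisms modulo all powers induces an isomorphism of adic
completions. -/
theorem AdicCompletion.exists_algEquiv {A A' : Type*} [CommRing A] [CommRing A'] [Algebra A A']
    (I : Ideal A) (I' : Ideal A') (hcomap : ∀ n, (I' ^ n).comap (algebraMap A A') = I ^ n)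
    (hsurj : ∀ n, ∀ x : A', ∃ a : A, algebraMap A A' a - x ∈ I' ^ n) :
    Nonempty (AdicCompletion I A ≃ₐ[A] AdicCompletion I' A') := by
  let g (n : ℕ) : A ⧸ I ^ n →+* A' ⧸ I' ^ n :=
    Ideal.quotientMap (I' ^ n) (algebraMap A A') (hcomap n).ge
  have hg (n : ℕ) : Function.Bijective (g n) := by
    refine ⟨Ideal.quotientMap_injective' (hcomap n).le, fun y ↦ ?_⟩
    obtain ⟨x, rfl⟩ := Ideal.Quotient.mk_surjective y
    obtain ⟨a, ha⟩ := hsurj n x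
    exact ⟨Ideal.Quotient.mk _ a, by simpa [g] using Ideal.Quotient.eq.2 ha⟩
  let q (n : ℕ) : A ⧸ I ^ n ≃+* A' ⧸ I' ^ n := RingEquiv.ofBijective (g n) (hg n)
  have hq {k n : ℕ} (h : k ≤ n) (x : A ⧸ I ^ n) :
      Ideal.Quotient.factorPow I' h (q n x) = q k (Ideal.Quotient.factorPow I h x) := by
    obtain ⟨x, rfl⟩ := Ideal.Quotient.mk_surjective x
    rfl
  let f : AdicCompletion I A →+* AdicCompletion I' A' :=
    AdicCompletion.liftRingHom I'
      (fun n ↦ (q n).toRingHom.comp (AdicCompletion.evalₐ I n).toRingHom)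
      (fun {k n} h ↦ by
        ext x
        exact (hq h _).trans (congrArg (q k) (AdicCompletion.factorPow_evalₐ I h x)))
  let f' : AdicCompletion I' A' →+* AdicCompletion I A :=
    AdicCompletion.liftRingHom I
      (fun n ↦ (q n).symm.toRingHom.comp (AdicCompletion.evalₐ I' n).toRingHom)
      (fun {k n} h ↦ by
        ext x
        apply (q k).injective
        refine (hq h _).symm.trans ?_
        simpa using AdicCompletion.factorPow_evalₐ I' h x)
  have hf (n : ℕ) (x) : AdicCompletion.evalₐ I' n (f x) = q n (AdicCompletion.evalₐ I n x) :=
    AdicCompletion.evalₐ_liftRingHom _ _ _ n x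
  have hf' (n : ℕ) (x) :
      AdicCompletion.evalₐ I n (f' x) = (q n).symm (AdicCompletion.evalₐ I' n x) :=
    AdicCompletion.evalₐ_liftRingHom _ _ _ n x
  refine ⟨AlgEquiv.ofRingEquiv (f := RingEquiv.ofRingHom f f' ?_ ?_) fun a ↦ ?_⟩
  · ext1 x
    exact AdicCompletion.ext_evalₐ fun n ↦ by simp [hf, hf']
  · ext1 x
    exact AdicCompletion.ext_evalₐ fun n ↦ by simp [hf, hf']
  · refine AdicCompletion.ext_evalₐ fun n ↦ ?_
    refine (hf n _).trans ?_
    rw [IsScalarTower.algebraMap_apply A A' (AdicCompletion I' A'), AlgHom.commutes,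
      AlgHom.commutes]
    rfl

end Completion

section GRing

/-- The field `L` is finite over the residue field of the kernel of `R → L`. -/
def FracFinite (R L : Type*) [CommRing R] [Field L] [Algebra R L] : Prop :=
  ∃ s : Finset L, ∀ x : L, ∃ r : R, algebraMap R L r ≠ 0 ∧ r • x ∈ Submodule.span R (s : Set L)

theorem FracFinite.of_isLocalization {R R' L : Type*} [CommRing R] [CommRing R'] [Field L]
    [Algebra R R'] [Algebra R L] [Algebra R' L] [IsScalarTower R R' L] (M : Submonoid R)
    [IsLocalization M R'] (h : FracFinite R' L) : FracFinite R L := by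
  obtain ⟨s, hs⟩ := h
  refine ⟨s, fun x ↦ ?_⟩
  obtain ⟨r, hr, hx⟩ := hs x
  obtain ⟨t, ht⟩ := multiple_mem_span_of_mem_localization_span M R' (s : Set L) _ hx
  obtain ⟨⟨a, m⟩, ham⟩ := IsLocalization.surj M r
  have hu (t : M) : algebraMap R L t ≠ 0 := by
    rw [IsScalarTower.algebraMap_apply R R' L]
    exact ((IsLocalization.map_units R' t).map _).ne_zero
  refine ⟨t * a, ?_, ?_⟩
  · rw [map_mul, IsScalarTower.algebraMap_apply R R' L a, ← ham, map_mul,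
      ← IsScalarTower.algebraMap_apply R R' L]
    exact mul_ne_zero (hu t) (mul_ne_zero hr (hu m))
  · have : (t * a : R) • x = (m : R) • (t : R) • r • x := by
      rw [← algebraMap_smul R' (t * a : R), map_mul, ← ham, ← algebraMap_smul R' (m : R),
        ← algebraMap_smul R' (t : R)]
      simp only [smul_smul]
      congr 1
      ring
    rw [this]
    exact Submodule.smul_mem _ _ ht

theorem FracFinite.of_surjective {R R' L : Type*} [CommRing R] [CommRing R'] [Field L]
    [Algebra R R'] [Algebra R L] [Algebra R' L] [IsScalarTower R R' L]
    (hR : Function.Surjective (algebraMap R R')) (h : FracFinite R' L) : FracFinite R L := by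
  obtain ⟨s, hs⟩ := h
  refine ⟨s, fun x ↦ ?_⟩
  obtain ⟨r, hr, hx⟩ := hs x
  obtain ⟨r, rfl⟩ := hR r
  rw [← IsScalarTower.algebraMap_apply] at hr
  rw [algebraMap_smul] at hx
  refine ⟨r, hr, ?_⟩
  rwa [← Submodule.restrictScalars_span R R' hR, Submodule.restrictScalars_mem]

theorem FracFinite.tower_top {R L : Type*} (R' : Type*) [CommRing R] [CommRing R'] [Field L]
    [Algebra R R'] [Algebra R L] [Algebra R' L] [IsScalarTower R R' L]
    (h : FracFinite R L) : FracFinite R' L := by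
  obtain ⟨s, hs⟩ := h
  refine ⟨s, fun x ↦ ?_⟩
  obtain ⟨r, hr, hx⟩ := hs x
  refine ⟨algebraMap R R' r, by rwa [← IsScalarTower.algebraMap_apply], ?_⟩
  rw [algebraMap_smul]
  exact Submodule.span_le_restrictScalars R R' _ hx

theorem FracFinite.of_finite (K L : Type*) [Field K] [Field L] [Algebra K L]
    [Module.Finite K L] : FracFinite K L := by
  obtain ⟨s, hs⟩ := Module.Finite.fg_top (R := K) (M := L)
  exact ⟨s, fun x ↦ ⟨1, by simp, hs ▸ trivial⟩⟩

theorem FracFinite.finite {K L : Type*} [Field K] [Field L] [Algebra K L]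
    (h : FracFinite K L) : Module.Finite K L := by
  obtain ⟨s, hs⟩ := h
  refine ⟨⟨s, eq_top_iff.2 fun x _ ↦ ?_⟩⟩
  obtain ⟨r, hr, hx⟩ := hs x
  have hr0 : r ≠ 0 := by rintro rfl; simp at hr
  simpa [smul_smul, inv_mul_cancel₀ hr0] using Submodule.smul_mem _ r⁻¹ hx

/-- The map from the residue field of the kernel of an algebra map to a field. -/
theorem exists_algebra_residueField_ker (R L : Type*) [CommRing R] [Field L] [Algebra R L]
    (p : Ideal R) [p.IsPrime] (hp : ∀ x, x ∈ p ↔ algebraMap R L x = 0) :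
    ∃ (_ : Algebra p.ResidueField L), IsScalarTower R p.ResidueField L := by
  let f : p.ResidueField →ₐ[R] L :=
    Ideal.ResidueField.liftₐ _ (Algebra.ofId R L) (fun x hx ↦ (hp x).1 hx) (fun x hx ↦
      isUnit_iff_ne_zero.2 fun h ↦ hx ((hp x).2 h))
  letI := f.toRingHom.toAlgebra
  exact ⟨inferInstance, IsScalarTower.of_algebraMap_eq fun r ↦ (f.commutes r).symm⟩

theorem Algebra.HasGeometricallyRegularFibers.isRegularRing_tensorProduct {R X L : Type u}
    [CommRing R] [CommRing X] [Algebra R X] (h : Algebra.HasGeometricallyRegularFibers R X)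
    [Field L] [Algebra R L] (hL : FracFinite R L) : IsRegularRing (L ⊗[R] X) := by
  obtain ⟨p, hp, hpk⟩ : ∃ p : Ideal R, p.IsPrime ∧ ∀ x, x ∈ p ↔ algebraMap R L x = 0 :=
    ⟨RingHom.ker (algebraMap R L), RingHom.ker_isPrime _, fun x ↦ Iff.rfl⟩
  obtain ⟨_, _⟩ := exists_algebra_residueField_ker R L p hpk
  have : Module.Finite p.ResidueField L := (hL.tower_top _).finite
  have h1 := (isRegularRingOld_iff _).1 (h p inferInstance L)
  exact IsRegularRing.of_ringEquiv (Algebra.TensorProduct.cancelBaseChange R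
    p.ResidueField p.ResidueField L X).toRingEquiv

theorem Algebra.HasGeometricallyRegularFibers.of_forall {R X : Type u}
    [CommRing R] [CommRing X] [Algebra R X]
    (h : ∀ (L : Type u) [Field L] [Algebra R L], FracFinite R L → IsRegularRing (L ⊗[R] X)) :
    Algebra.HasGeometricallyRegularFibers R X := by
  intro p hp L _ _ _
  letI : Algebra R L := ((algebraMap p.ResidueField L).comp (algebraMap R p.ResidueField)).toAlgebra
  haveI : IsScalarTower R p.ResidueField L := .of_algebraMap_eq fun _ ↦ rfl
  letI : Algebra (R ⧸ p) L :=
    ((algebraMap p.ResidueField L).comp (algebraMap (R ⧸ p) p.ResidueField)).toAlgebra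
  haveI : IsScalarTower (R ⧸ p) p.ResidueField L := .of_algebraMap_eq fun _ ↦ rfl
  haveI : IsScalarTower R (R ⧸ p) L := .of_algebraMap_eq fun _ ↦ rfl
  have h1 : FracFinite (R ⧸ p) L :=
    (FracFinite.of_finite p.ResidueField L).of_isLocalization (nonZeroDivisors (R ⧸ p))
  have h2 : FracFinite R L := h1.of_surjective Ideal.Quotient.mk_surjective
  have h3 := h L h2
  refine (isRegularRingOld_iff _).2 ?_
  exact IsRegularRing.of_ringEquiv (R := L ⊗[R] X) (Algebra.TensorProduct.cancelBaseChange R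
    p.ResidueField p.ResidueField L X).symm.toRingEquiv

theorem IsGRing.isRegularRing_tensorProduct {A : Type u} [CommRing A] (h : IsGRing A)
    (q : Ideal A) [q.IsPrime] (L : Type u) [Field L] [Algebra A L] (hL : FracFinite A L) :
    IsRegularRing (L ⊗[A] AdicCompletion (maximalIdeal (Localization.AtPrime q))
        (Localization.AtPrime q)) := by
  by_cases hq : ∀ a, algebraMap A L a = 0 → a ∈ q
  · let f : Localization.AtPrime q →ₐ[A] L :=
      IsLocalization.liftAlgHom (M := q.primeCompl) (f := Algebra.ofId A L) fun y ↦
        isUnit_iff_ne_zero.2 fun h0 ↦ y.2 (hq y h0)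
    letI := f.toRingHom.toAlgebra
    haveI : IsScalarTower A (Localization.AtPrime q) L :=
      IsScalarTower.of_algebraMap_eq fun r ↦ (f.commutes r).symm
    have h1 := (h q inferInstance).isRegularRing_tensorProduct
      (hL.tower_top (Localization.AtPrime q))
    exact IsRegularRing.of_ringEquiv (IsLocalization.algebraTensorEquiv q.primeCompl
      (Localization.AtPrime q) L _).toRingEquiv
  · push Not at hq
    obtain ⟨a, ha, haq⟩ := hq
    have hu : IsUnit (algebraMap A (AdicCompletion (maximalIdeal (Localization.AtPrime q))
        (Localization.AtPrime q)) a) := by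
      rw [IsScalarTower.algebraMap_apply A (Localization.AtPrime q)]
      exact (IsLocalization.map_units (Localization.AtPrime q) (⟨a, haq⟩ : q.primeCompl)).map _
    have : Subsingleton (L ⊗[A] AdicCompletion (maximalIdeal (Localization.AtPrime q))
        (Localization.AtPrime q)) := by
      have h0 : algebraMap A (L ⊗[A] AdicCompletion (maximalIdeal (Localization.AtPrime q))
        (Localization.AtPrime q)) a = 0 := by
        rw [IsScalarTower.algebraMap_apply A L, ha, map_zero]
      have h1 : IsUnit (algebraMap A (L ⊗[A] AdicCompletion (maximalIdeal (Localization.AtPrime q))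
        (Localization.AtPrime q)) a) := by
        have := hu.map (Algebra.TensorProduct.includeRight (R := A) (A := L))
        rwa [AlgHom.commutes] at this
      rw [h0] at h1
      exact isUnit_zero_iff.1 h1 |> subsingleton_of_zero_eq_one
    exact IsRegularRing.of_subsingleton _

theorem IsGRing.of_forall {A : Type u} [CommRing A]
    (h : ∀ (q : Ideal A) [q.IsPrime] (L : Type u) [Field L] [Algebra A L]
      [Algebra (Localization.AtPrime q) L] [IsScalarTower A (Localization.AtPrime q) L],
      FracFinite A L → IsRegularRing (L ⊗[A]
        AdicCompletion (maximalIdeal (Localization.AtPrime q)) (Localization.AtPrime q))) :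
    IsGRing A := by
  intro q hq
  refine .of_forall fun L _ _ hL ↦ ?_
  letI : Algebra A L :=
    ((algebraMap (Localization.AtPrime q) L).comp (algebraMap A _)).toAlgebra
  haveI : IsScalarTower A (Localization.AtPrime q) L := .of_algebraMap_eq fun _ ↦ rfl
  have h1 := h q L (hL.of_isLocalization q.primeCompl)
  exact IsRegularRing.of_ringEquiv (IsLocalization.algebraTensorEquiv q.primeCompl
      (Localization.AtPrime q) L _).symm.toRingEquiv

end GRing

section Glued

theorem mem_nonZeroDivisors_of_forall_notMem_minimalPrimes {B : Type*} [CommRing B] [IsReduced B]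
    {b : B} (hb : ∀ Q ∈ minimalPrimes B, b ∉ Q) : b ∈ nonZeroDivisors B := by
  refine mem_nonZeroDivisors_iff_right.2 fun c hc ↦ ?_
  have h : c ∈ sInf (minimalPrimes B) := by
    refine Submodule.mem_sInf.2 fun (Q : Ideal B) hQ ↦ ?_
    have hp : Q.IsPrime := hQ.1.1
    exact (hp.mem_or_mem (hc ▸ Q.zero_mem : c * b ∈ Q)).resolve_right (hb Q hQ)
  rw [minimalPrimes_eq_minimals, ← minimalPrimes_eq_minimals, minimalPrimes,
    Ideal.sInf_minimalPrimes] at h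
  simpa using h

/-- Prime avoidance for the pullback of a finite set of prime ideals. -/
theorem exists_mem_forall_notMem_of_finite {S : Type*} [CommRing S] (I : Ideal S)
    {T : Set (Ideal S)} (hT : T.Finite) (hprime : ∀ Q ∈ T, Q.IsPrime) (h : ∀ Q ∈ T, ¬ I ≤ Q) :
    ∃ x ∈ I, ∀ Q ∈ T, x ∉ Q := by
  by_contra! hc
  have := (Ideal.subset_union_prime (s := hT.toFinset) (f := id) (I := I) ⊥ ⊥
    (fun i hi _ _ ↦ hprime i (by simpa using hi))).1 (fun x hx ↦ by
      obtain ⟨Q, hQ, hxQ⟩ := hc x hx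
      simp only [Set.mem_iUnion]
      exact ⟨Q, by simpa using hQ, hxQ⟩)
  obtain ⟨Q, hQ, hle⟩ := this
  exact h Q (by simpa using hQ) hle

theorem exists_mem_nonZeroDivisors_of_notMem_minimalPrimes {B : Type*} [CommRing B] [IsReduced B]
    [IsNoetherianRing B] (P : Ideal B) [hP : P.IsPrime] (h : P ∉ minimalPrimes B) :
    ∃ t ∈ P, t ∈ nonZeroDivisors B := by
  obtain ⟨t, htP, ht⟩ := exists_mem_forall_notMem_of_finite P
    (minimalPrimes.finite_of_isNoetherianRing B) (fun Q hQ ↦ hQ.1.1) fun Q hQ hle ↦ h (by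
      have := hQ.2 ⟨hP, bot_le⟩ hle
      rwa [le_antisymm hle this])
  exact ⟨t, htP, mem_nonZeroDivisors_of_forall_notMem_minimalPrimes ht⟩

/-- The properties of a subring that is dense for the topologies defined by regular elements,
closed under division by regular elements, and whose induced minimal primes are separated. -/
structure IsGluedSubring (S B : Type*) [CommRing S] [CommRing B] [Algebra S B] : Prop where
  injective : Function.Injective (algebraMap S B)
  approx : ∀ t ∈ nonZeroDivisors B, ∀ b : B, ∃ s : S, ∃ c : B, b = algebraMap S B s + t * c
  closed : ∀ s : S, algebraMap S B s ∈ nonZeroDivisors B → ∀ (b : B) (s' : S),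
    algebraMap S B s * b = algebraMap S B s' → ∃ a : S, algebraMap S B a = b
  separated : ∀ Q ∈ minimalPrimes B, ∃ w : S, algebraMap S B w ∉ Q ∧
    ∀ Q' ∈ minimalPrimes B, algebraMap S B w ∈ Q' ∨
      Q'.comap (algebraMap S B) = Q.comap (algebraMap S B)

namespace IsGluedSubring

variable {S B : Type*} [CommRing S] [CommRing B] [Algebra S B]

theorem isLocalHom (h : IsGluedSubring S B) : IsLocalHom (algebraMap S B) where
  map_nonunit s hs := by
    obtain ⟨b, hb⟩ := hs.exists_right_inv
    obtain ⟨a, rfl⟩ := h.closed s hs.mem_nonZeroDivisors b 1 (by simpa using hb)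
    exact IsUnit.of_mul_eq_one a (h.injective (by simpa using hb))

theorem isLocalRing (h : IsGluedSubring S B) [IsLocalRing B] : IsLocalRing S :=
  have := h.isLocalHom
  RingHom.domain_isLocalRing (algebraMap S B)

theorem isReduced (h : IsGluedSubring S B) [IsReduced B] : IsReduced S :=
  isReduced_of_injective _ h.injective

theorem mem_of_mem_minimalPrimes_comap (h : IsGluedSubring S B) [IsReduced B] {Q : Ideal B}
    (hQ : Q ∈ minimalPrimes B) :
    ∃ w : S, algebraMap S B w ∉ Q ∧ (∀ Q' ∈ minimalPrimes B, algebraMap S B w ∈ Q' ∨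
      Q'.comap (algebraMap S B) = Q.comap (algebraMap S B)) ∧
      ∀ x ∈ Q.comap (algebraMap S B), w * x = 0 := by
  obtain ⟨w, hw, hw'⟩ := h.separated Q hQ
  refine ⟨w, hw, hw', fun x hx ↦ h.injective ?_⟩
  have : algebraMap S B (w * x) ∈ sInf (minimalPrimes B) := by
    refine Submodule.mem_sInf.2 fun Q' hQ' ↦ ?_
    rw [map_mul]
    obtain h1 | h1 := hw' Q' hQ'
    · exact Ideal.mul_mem_right _ _ h1
    · exact Ideal.mul_mem_left _ _ (by rw [← h1] at hx; exact hx)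
  rw [minimalPrimes, Ideal.sInf_minimalPrimes] at this
  simpa using this

theorem eq_comap_of_le_comap (h : IsGluedSubring S B) [IsReduced B] {Q : Ideal B}
    (hQ : Q ∈ minimalPrimes B)
    {p : Ideal S} [hp : p.IsPrime] (hle : p ≤ Q.comap (algebraMap S B)) :
    p = Q.comap (algebraMap S B) := by
  obtain ⟨w, hw, -, hw'⟩ := h.mem_of_mem_minimalPrimes_comap hQ
  refine le_antisymm hle fun x hx ↦ ?_
  exact (hp.mem_or_mem (hw' x hx ▸ p.zero_mem : w * x ∈ p)).resolve_left fun hc ↦ hw (hle hc)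

theorem exists_eq_comap_or_exists_mem (h : IsGluedSubring S B) [IsReduced B] [IsNoetherianRing B]
    (p : Ideal S)
    [hp : p.IsPrime] :
    (∃ Q ∈ minimalPrimes B, p = Q.comap (algebraMap S B)) ∨
      ∃ s ∈ p, algebraMap S B s ∈ nonZeroDivisors B := by
  refine or_iff_not_imp_left.2 fun hne ↦ ?_
  obtain ⟨s, hs, hs'⟩ := exists_mem_forall_notMem_of_finite p
    (T := Ideal.comap (algebraMap S B) '' minimalPrimes B)
    ((minimalPrimes.finite_of_isNoetherianRing B).image _)
    (by
      rintro _ ⟨Q, hQ, rfl⟩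
      have : Q.IsPrime := hQ.1.1
      infer_instance)
    (by
      rintro _ ⟨Q, hQ, rfl⟩ hle
      exact hne ⟨Q, hQ, h.eq_comap_of_le_comap hQ hle⟩)
  exact ⟨s, hs, mem_nonZeroDivisors_of_forall_notMem_minimalPrimes fun Q hQ ↦
    hs' _ ⟨Q, hQ, rfl⟩⟩

/-- Regular elements are associated to elements of the subring. -/
theorem exists_associated (h : IsGluedSubring S B) [IsLocalRing B] {t : B}
    (ht : t ∈ nonZeroDivisors B) :
    ∃ s : S, Associated t (algebraMap S B s) := by
  by_cases hu : IsUnit t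
  · exact ⟨1, by rw [map_one]; exact associated_one_iff_isUnit.2 hu⟩
  · obtain ⟨s, c, hs⟩ := h.approx (t * t) (mul_mem ht ht) t
    have hm : IsUnit (1 - t * c) := by
      by_contra hc
      have h1 : (1 - t * c) + t * c ∈ maximalIdeal B :=
        add_mem ((mem_maximalIdeal _).2 hc) (Ideal.mul_mem_right _ _ ((mem_maximalIdeal _).2 hu))
      simp only [sub_add_cancel] at h1
      exact (mem_maximalIdeal _).1 h1 isUnit_one
    refine ⟨s, hm.unit, ?_⟩
    rw [IsUnit.unit_spec]
    linear_combination hs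

theorem exists_mem_comap (h : IsGluedSubring S B) [IsLocalRing B] {J : Ideal B} {t : B}
    (htJ : t ∈ J)
    (ht : t ∈ nonZeroDivisors B) :
    ∃ s : S, algebraMap S B s ∈ J ∧ algebraMap S B s ∈ nonZeroDivisors B := by
  obtain ⟨s, u, hs⟩ := h.exists_associated ht
  exact ⟨s, hs ▸ Ideal.mul_mem_right _ _ htJ, hs ▸ mul_mem ht u.isUnit.mem_nonZeroDivisors⟩

theorem exists_sub_mem (h : IsGluedSubring S B) {J : Ideal B} {t : B} (htJ : t ∈ J)
    (ht : t ∈ nonZeroDivisors B) (b : B) : ∃ s : S, algebraMap S B s - b ∈ J := by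
  obtain ⟨s, c, hs⟩ := h.approx t ht b
  refine ⟨s, ?_⟩
  rw [hs, sub_add_cancel_left, neg_mem_iff]
  exact Ideal.mul_mem_right _ _ htJ

/-- Ideals containing a regular element are extended from the subring. -/
theorem map_comap (h : IsGluedSubring S B) [IsLocalRing B] {J : Ideal B} {t : B} (htJ : t ∈ J)
    (ht : t ∈ nonZeroDivisors B) : (J.comap (algebraMap S B)).map (algebraMap S B) = J := by
  refine le_antisymm Ideal.map_comap_le fun j hj ↦ ?_
  obtain ⟨s, hsJ, hs⟩ := h.exists_mem_comap htJ ht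
  obtain ⟨a, c, rfl⟩ := h.approx _ hs j
  refine add_mem (Ideal.mem_map_of_mem _ ?_)
    (Ideal.mul_mem_right _ _ (Ideal.mem_map_of_mem _ hsJ))
  exact (Ideal.add_mem_iff_left _ (Ideal.mul_mem_right _ _ hsJ)).1 hj

theorem comap_map (h : IsGluedSubring S B) {I : Ideal S} {s : S} (hsI : s ∈ I)
    (hs : algebraMap S B s ∈ nonZeroDivisors B) :
    (I.map (algebraMap S B)).comap (algebraMap S B) = I := by
  refine le_antisymm (fun x hx ↦ ?_) Ideal.le_comap_map
  have key : ∀ y ∈ I.map (algebraMap S B), ∃ i ∈ I, ∃ c : B,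
      y = algebraMap S B i + algebraMap S B s * c := by
    intro y hy
    refine Submodule.span_induction ?_ ⟨0, I.zero_mem, 0, by simp⟩ ?_ ?_ hy
    · rintro _ ⟨i, hi, rfl⟩
      exact ⟨i, hi, 0, by simp⟩
    · rintro _ _ - - ⟨i, hi, c, rfl⟩ ⟨j, hj, d, rfl⟩
      exact ⟨i + j, add_mem hi hj, c + d, by simp only [map_add]; ring⟩
    · rintro b _ - ⟨i, hi, c, rfl⟩
      obtain ⟨a, d, rfl⟩ := h.approx _ hs b
      refine ⟨a * i, I.mul_mem_left _ hi, d * algebraMap S B i +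
        (algebraMap S B a + algebraMap S B s * d) * c, ?_⟩
      simp only [map_mul, smul_eq_mul]
      ring
  obtain ⟨i, hi, c, hic⟩ := key _ hx
  obtain ⟨a, rfl⟩ := h.closed s hs c (x - i) (by rw [map_sub, hic]; ring)
  have : x = i + s * a := h.injective (by simpa using hic)
  rw [this]
  exact add_mem hi (I.mul_mem_right _ hsI)

theorem fg_of_mem_nonZeroDivisors (h : IsGluedSubring S B) [IsNoetherianRing B] {I : Ideal S}
    {s : S} (hsI : s ∈ I)
    (hs : algebraMap S B s ∈ nonZeroDivisors B) : I.FG := by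
  have hfg : (I.map (algebraMap S B)).FG := IsNoetherian.noetherian _
  obtain ⟨T, hT, hspan⟩ := Submodule.fg_span_iff_fg_span_finset_subset _ |>.1 hfg
  choose! g hg hg' using hT
  classical
  let I' : Ideal S := Ideal.span (insert s (T.image g : Finset S))
  have hle : I' ≤ I := by
    refine Ideal.span_le.2 (Set.insert_subset hsI ?_)
    intro x hx
    simp only [Finset.coe_image, Set.mem_image] at hx
    obtain ⟨y, hy, rfl⟩ := hx
    exact hg hy
  have hmap : I'.map (algebraMap S B) = I.map (algebraMap S B) := by
    refine le_antisymm (Ideal.map_mono hle) ?_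
    have : I.map (algebraMap S B) = Ideal.span (T : Set B) := hspan
    rw [this, Ideal.span_le]
    intro y hy
    rw [← hg' hy]
    exact Ideal.mem_map_of_mem _ (Ideal.subset_span (Set.mem_insert_of_mem _
      (Finset.mem_coe.2 (Finset.mem_image_of_mem g hy))))
  have hI' : I' = I := by
    rw [← h.comap_map hsI hs, ← hmap, h.comap_map (Ideal.subset_span (Set.mem_insert _ _)) hs]
  rw [← hI']
  exact ⟨insert s (T.image g), by simp [I', Ideal.span]⟩

theorem fg_comap_minimalPrimes (h : IsGluedSubring S B) [IsReduced B] [IsNoetherianRing B]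
    {Q : Ideal B}
    (hQ : Q ∈ minimalPrimes B) : (Q.comap (algebraMap S B)).FG := by
  have hQp : Q.IsPrime := hQ.1.1
  set p := Q.comap (algebraMap S B) with hp
  obtain ⟨w, hwQ, hw, hw0⟩ := h.mem_of_mem_minimalPrimes_comap hQ
  obtain ⟨u, hup, hu⟩ := exists_mem_forall_notMem_of_finite p
    (T := {q | ∃ Q' ∈ minimalPrimes B, q = Q'.comap (algebraMap S B) ∧ q ≠ p})
    (((minimalPrimes.finite_of_isNoetherianRing B).image (Ideal.comap (algebraMap S B))).subset
      (by rintro _ ⟨Q', hQ', rfl, -⟩; exact ⟨Q', hQ', rfl⟩))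
    (by
      rintro _ ⟨Q', hQ', rfl, -⟩
      have : Q'.IsPrime := hQ'.1.1
      infer_instance)
    (by
      rintro _ ⟨Q', hQ', rfl, hne⟩ hle
      exact hne (h.eq_comap_of_le_comap hQ' hle).symm)
  have ht : algebraMap S B (u + w) ∈ nonZeroDivisors B := by
    refine mem_nonZeroDivisors_of_forall_notMem_minimalPrimes fun Q' hQ' hmem ↦ ?_
    rw [map_add] at hmem
    by_cases hQQ : Q'.comap (algebraMap S B) = p
    · have h1 : u ∈ Q'.comap (algebraMap S B) := hQQ ▸ hup
      have h2 : w ∈ Q'.comap (algebraMap S B) := (Ideal.add_mem_iff_right Q' h1).1 hmem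
      rw [hQQ] at h2
      exact hwQ h2
    · have h1 : algebraMap S B w ∈ Q' := (hw Q' hQ').resolve_right hQQ
      exact hu _ ⟨Q', hQ', rfl, hQQ⟩ ((Ideal.add_mem_iff_left _ h1).1 hmem)
  have htp : u + w ∉ p := fun hc ↦ hwQ ((Ideal.add_mem_iff_right p hup).1 hc)
  obtain ⟨T, hT⟩ := h.fg_of_mem_nonZeroDivisors (I := p ⊔ Ideal.span {u + w})
    (Ideal.mem_sup_right (Ideal.mem_span_singleton_self _)) ht
  have hdec : ∀ x ∈ T, ∃ a ∈ p, ∃ r : S, x = a + (u + w) * r := by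
    intro x hx
    have : x ∈ p ⊔ Ideal.span {u + w} := hT ▸ Submodule.subset_span hx
    obtain ⟨a, ha, y, hy, rfl⟩ := Submodule.mem_sup.1 this
    obtain ⟨r, rfl⟩ := Ideal.mem_span_singleton'.1 hy
    exact ⟨a, ha, r, by ring⟩
  choose! g hg r hr using hdec
  classical
  refine ⟨insert u (T.image g), le_antisymm ?_ fun x hx ↦ ?_⟩
  · refine Submodule.span_le.2 fun x hx ↦ ?_
    simp only [Finset.coe_insert, Finset.coe_image, Set.mem_insert_iff, Set.mem_image] at hx
    obtain rfl | ⟨y, hy, rfl⟩ := hx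
    · exact hup
    · exact hg y hy
  · have hle : Submodule.span S (T : Set S) ≤
        Submodule.span S ((T.image g : Finset S) : Set S) ⊔ Ideal.span {u + w} := by
      refine Submodule.span_le.2 fun y hy ↦ ?_
      rw [hr y hy]
      exact add_mem (Submodule.mem_sup_left (Submodule.subset_span
        (Finset.mem_coe.2 (Finset.mem_image_of_mem g hy))))
        (Submodule.mem_sup_right (Ideal.mul_mem_right _ _ (Ideal.mem_span_singleton_self _)))
    have hx' : x ∈ Submodule.span S (T : Set S) := hT.ge (Ideal.mem_sup_left hx)
    obtain ⟨a, ha, y, hy, rfl⟩ := Submodule.mem_sup.1 (hle hx')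
    obtain ⟨c, rfl⟩ := Ideal.mem_span_singleton'.1 hy
    have hap : a ∈ p := by
      refine (Submodule.span_le.2 ?_ : _ ≤ p) ha
      intro z hz
      simp only [Finset.coe_image, Set.mem_image] at hz
      obtain ⟨z, hz, rfl⟩ := hz
      exact hg z hz
    have hcp : c ∈ p :=
      ((Ideal.IsPrime.comap (algebraMap S B) : p.IsPrime).mem_or_mem
        ((Ideal.add_mem_iff_right p hap).1 hx)).resolve_right htp
    have : c * (u + w) = c * u := by
      rw [mul_add, mul_comm c w, hw0 c hcp, add_zero]
    rw [this, Finset.coe_insert]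
    exact add_mem (Submodule.span_mono (Set.subset_insert _ _) ha)
      (Submodule.smul_mem _ _ (Submodule.subset_span (Set.mem_insert _ _)))

theorem isNoetherianRing (h : IsGluedSubring S B) [IsReduced B] [IsNoetherianRing B] :
    IsNoetherianRing S := by
  refine IsNoetherianRing.of_prime fun p hp ↦ ?_
  obtain ⟨Q, hQ, rfl⟩ | ⟨s, hsp, hs⟩ := h.exists_eq_comap_or_exists_mem p
  · exact h.fg_comap_minimalPrimes hQ
  · exact h.fg_of_mem_nonZeroDivisors hsp hs

theorem isPrime_map (h : IsGluedSubring S B) {p : Ideal S} [hp : p.IsPrime] {s : S} (hsp : s ∈ p)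
    (hs : algebraMap S B s ∈ nonZeroDivisors B) : (p.map (algebraMap S B)).IsPrime := by
  have hcm := h.comap_map hsp hs
  have hbij : Function.Bijective (Ideal.quotientMap (p.map (algebraMap S B)) (algebraMap S B)
      hcm.ge) := by
    refine ⟨Ideal.quotientMap_injective' hcm.le, fun y ↦ ?_⟩
    obtain ⟨b, rfl⟩ := Ideal.Quotient.mk_surjective y
    obtain ⟨a, ha⟩ := h.exists_sub_mem (Ideal.mem_map_of_mem _ hsp) hs b
    exact ⟨Ideal.Quotient.mk _ a, by simpa using Ideal.Quotient.eq.2 ha⟩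
  have : IsDomain (B ⧸ p.map (algebraMap S B)) :=
    MulEquiv.isDomain _ (RingEquiv.ofBijective _ hbij).symm.toMulEquiv
  exact (Ideal.Quotient.isDomain_iff_prime _).1 this

theorem exists_comap_eq (h : IsGluedSubring S B) [IsReduced B] [IsNoetherianRing B] (p : Ideal S)
    [hp : p.IsPrime] :
    ∃ P : Ideal B, P.IsPrime ∧ P.comap (algebraMap S B) = p := by
  obtain ⟨Q, hQ, rfl⟩ | ⟨s, hsp, hs⟩ := h.exists_eq_comap_or_exists_mem p
  · exact ⟨Q, hQ.1.1, rfl⟩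
  · exact ⟨_, h.isPrime_map hsp hs, h.comap_map hsp hs⟩

theorem comap_maximalIdeal_pow (h : IsGluedSubring S B) [IsLocalRing B] [IsLocalRing S]
    (hM : (∃ t ∈ maximalIdeal B, t ∈ nonZeroDivisors B) ∨ Function.Surjective (algebraMap S B))
    (n : ℕ) : ((maximalIdeal B) ^ n).comap (algebraMap S B) = maximalIdeal S ^ n := by
  have := h.isLocalHom
  have hm : (maximalIdeal B).comap (algebraMap S B) = maximalIdeal S :=
    maximalIdeal_comap (algebraMap S B)
  obtain ⟨t, htM, ht⟩ | hsurj := hM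
  · obtain ⟨s, hsM, hs⟩ := h.exists_mem_comap htM ht
    rw [← h.map_comap htM ht, ← Ideal.map_pow, hm]
    refine h.comap_map (Ideal.pow_mem_pow (hm.le hsM) n) ?_
    rw [map_pow]
    exact pow_mem hs n
  · rw [← hm, ← Ideal.map_comap_of_surjective _ hsurj (maximalIdeal B), ← Ideal.map_pow,
      Ideal.comap_map_of_bijective _ ⟨h.injective, hsurj⟩, Ideal.map_comap_of_surjective _ hsurj]

theorem exists_sub_mem_maximalIdeal_pow (h : IsGluedSubring S B) [IsLocalRing B]
    (hM : (∃ t ∈ maximalIdeal B, t ∈ nonZeroDivisors B) ∨ Function.Surjective (algebraMap S B))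
    (n : ℕ) (b : B) : ∃ s : S, algebraMap S B s - b ∈ maximalIdeal B ^ n := by
  obtain ⟨t, htM, ht⟩ | hsurj := hM
  · exact h.exists_sub_mem (Ideal.pow_mem_pow htM n) (pow_mem ht n) b
  · obtain ⟨s, rfl⟩ := hsurj b
    exact ⟨s, by simp⟩

end IsGluedSubring

end Glued

section Auxiliary

/-- Flatness descends along a faithfully flat extension of the target. -/
theorem Module.Flat.of_flat_of_faithfullyFlat (R A A' : Type u) [CommRing R] [CommRing A]
    [CommRing A'] [Algebra R A] [Algebra R A'] [Algebra A A'] [IsScalarTower R A A']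
    [Module.Flat R A'] [Module.FaithfullyFlat A A'] : Module.Flat R A := by
  rw [Module.Flat.iff_lTensor_preserves_injective_linearMap]
  intro N P _ _ _ _ f hf
  let g : A ⊗[R] N →ₗ[A] A ⊗[R] P := TensorProduct.AlgebraTensorModule.lTensor A A f
  suffices Function.Injective g from this
  rw [← Module.FaithfullyFlat.lTensor_injective_iff_injective A A']
  have h1 : Function.Injective (f.lTensor A') :=
    Module.Flat.lTensor_preserves_injective_linearMap f hf
  have h2 : ∀ x, TensorProduct.AlgebraTensorModule.cancelBaseChange R A A A' P (g.lTensor A' x) =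
      f.lTensor A' (TensorProduct.AlgebraTensorModule.cancelBaseChange R A A A' N x) := by
    intro x
    induction x with
    | zero => simp
    | add x y hx hy => simp only [map_add, hx, hy]
    | tmul x y =>
      induction y with
      | zero => simp
      | add y z hy hz => simp only [tmul_add, map_add, hy, hz]
      | tmul y z => simp [g]
  intro x y hxy
  apply (TensorProduct.AlgebraTensorModule.cancelBaseChange R A A A' N).injective
  apply h1
  rw [← h2, ← h2, hxy]

theorem IsRegularRing.of_isArtinianRing_of_isReduced (R : Type*) [CommRing R] [IsArtinianRing R]
    [IsReduced R] : IsRegularRing R := by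
  letI (I : MaximalSpectrum R) : Field (R ⧸ I.asIdeal) := Ideal.Quotient.field _
  have := IsRegularRing.pi (fun I : MaximalSpectrum R ↦ R ⧸ I.asIdeal)
  exact IsRegularRing.of_ringEquiv (IsArtinianRing.equivPi R).symm.toRingEquiv

theorem isReduced_of_isArtinianRing_of_isRegularRing (R : Type*) [CommRing R] [IsArtinianRing R]
    [IsRegularRing R] : IsReduced R := by
  refine isReduced_ofLocalizationMaximal R fun J hJ ↦ ?_
  have : IsRegularLocalRing (Localization.AtPrime J) := inferInstance
  have : Ring.KrullDimLE 0 (Localization.AtPrime J) := inferInstance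
  have hf := IsRegularLocalRing.isField_of_ringKrullDim_eq_zero (A := Localization.AtPrime J)
    (ringKrullDimZero_iff_ringKrullDim_eq_zero.1 this)
  letI := hf.toField
  exact inferInstanceAs (IsReduced (Localization.AtPrime J))

theorem isArtinianRing_and_isReduced_of_surjective {L R : Type*} [Field L] [CommRing R]
    (f : L →+* R) (hf : Function.Surjective f) : IsArtinianRing R ∧ IsReduced R := by
  refine ⟨hf.isArtinianRing, ?_⟩
  cases subsingleton_or_nontrivial R
  · infer_instance
  · let e := RingEquiv.ofBijective f ⟨f.injective, hf⟩
    exact isReduced_of_injective e.symm e.symm.injective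

/-- Regularity of `L ⊗ X` over `S` reduces to regularity over `B` of the factors of `L ⊗ B`. -/
theorem isRegularRing_tensorProduct_of_isArtinianRing (S B L X : Type u) [CommRing S] [CommRing B]
    [Algebra S B] [Field L] [Algebra S L] [CommRing X] [Algebra S X] [Algebra B X]
    [IsScalarTower S B X] [IsArtinianRing (B ⊗[S] L)] [IsReduced (B ⊗[S] L)]
    (hL : FracFinite S L)
    (hX : ∀ (L' : Type u) [Field L'] [Algebra B L'], FracFinite B L' →
      IsRegularRing (L' ⊗[B] X)) : IsRegularRing (L ⊗[S] X) := by
  classical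
  letI (I : MaximalSpectrum (B ⊗[S] L)) : Field ((B ⊗[S] L) ⧸ I.asIdeal) := Ideal.Quotient.field _
  have hfin (I : MaximalSpectrum (B ⊗[S] L)) : FracFinite B ((B ⊗[S] L) ⧸ I.asIdeal) := by
    obtain ⟨s, hs⟩ := hL
    let f : L →ₐ[S] (B ⊗[S] L) ⧸ I.asIdeal :=
      (Ideal.Quotient.mkₐ S I.asIdeal).comp Algebra.TensorProduct.includeRight
    refine ⟨s.image f, fun x ↦ ?_⟩
    have key : ∀ z : B ⊗[S] L, ∃ r : S, algebraMap S L r ≠ 0 ∧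
        algebraMap S B r • (Ideal.Quotient.mk I.asIdeal z) ∈
          Submodule.span B ((s.image f : Finset _) : Set ((B ⊗[S] L) ⧸ I.asIdeal)) := by
      intro z
      induction z with
      | zero => exact ⟨1, by simp, by simp⟩
      | add y z hy hz =>
        obtain ⟨r, hr, hy⟩ := hy
        obtain ⟨r', hr', hz⟩ := hz
        refine ⟨r * r', by simp [hr, hr'], ?_⟩
        rw [map_add, smul_add, map_mul]
        refine add_mem ?_ ?_
        · rw [mul_comm, mul_smul]
          exact Submodule.smul_mem _ _ hy
        · rw [mul_smul]
          exact Submodule.smul_mem _ _ hz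
      | tmul b l =>
        obtain ⟨r, hr, hl⟩ := hs l
        refine ⟨r, hr, ?_⟩
        have h1 : Ideal.Quotient.mk I.asIdeal (b ⊗ₜ[S] l) = b • f l := by
          have : b ⊗ₜ[S] l = b • ((1 : B) ⊗ₜ[S] l) := by simp [smul_tmul']
          rw [this]
          rfl
        have h2 : algebraMap S B r • b • f l = b • f (r • l) := by
          rw [map_smul, smul_comm, algebraMap_smul]
        rw [h1, h2]
        refine Submodule.smul_mem _ _ ?_
        have h3 : f (r • l) ∈ (Submodule.span S (s : Set L)).map f.toLinearMap :=
          Submodule.mem_map_of_mem hl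
        rw [Submodule.map_span] at h3
        rw [Finset.coe_image]
        exact Submodule.span_le_restrictScalars S B _ h3
    obtain ⟨z, rfl⟩ := Ideal.Quotient.mk_surjective x
    obtain ⟨r, hr, hz⟩ := key z
    refine ⟨algebraMap S B r, ?_, hz⟩
    rw [← IsScalarTower.algebraMap_apply S B]
    rw [← f.commutes]
    exact (map_ne_zero_iff f f.toRingHom.injective).2 hr
  have hreg (I : MaximalSpectrum (B ⊗[S] L)) : IsRegularRing (X ⊗[B] ((B ⊗[S] L) ⧸ I.asIdeal)) := by
    have := hX _ (hfin I)
    exact IsRegularRing.of_ringEquiv (Algebra.TensorProduct.comm B _ X).toRingEquiv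
  have hpi := IsRegularRing.pi (fun I : MaximalSpectrum (B ⊗[S] L) ↦
    X ⊗[B] ((B ⊗[S] L) ⧸ I.asIdeal))
  letI := Fintype.ofFinite (MaximalSpectrum (B ⊗[S] L))
  let e1 := (Algebra.TensorProduct.piRight B B X
    (fun I : MaximalSpectrum (B ⊗[S] L) ↦ (B ⊗[S] L) ⧸ I.asIdeal)).toRingEquiv
  let e2 : X ⊗[B] (B ⊗[S] L) ≃ₐ[B]
      X ⊗[B] ((I : MaximalSpectrum (B ⊗[S] L)) → (B ⊗[S] L) ⧸ I.asIdeal) :=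
    Algebra.TensorProduct.congr (AlgEquiv.refl (R := B) (A₁ := X))
    ((IsArtinianRing.equivPi (B ⊗[S] L)).restrictScalars B)
  let e3 := (Algebra.TensorProduct.cancelBaseChange S B B X L).toRingEquiv
  let e4 := (Algebra.TensorProduct.comm S L X).toRingEquiv
  exact IsRegularRing.of_ringEquiv
    (((e1.symm.trans e2.symm.toRingEquiv).trans e3).trans e4.symm)

end Auxiliary

namespace IsGluedSubring

theorem isField_localization {S B : Type*} [CommRing S] [CommRing B] [Algebra S B]
    (h : IsGluedSubring S B) [IsReduced B] {Q : Ideal B} (hQ : Q ∈ minimalPrimes B)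
    (q : Ideal S) [q.IsPrime] (hq : q = Q.comap (algebraMap S B)) :
    IsField (Localization.AtPrime q) := by
  rw [IsLocalRing.isField_iff_maximalIdeal_eq, ← Localization.AtPrime.map_eq_maximalIdeal,
    eq_bot_iff, Ideal.map_le_iff_le_comap]
  intro a ha
  obtain ⟨w, hw, -, hw0⟩ := h.mem_of_mem_minimalPrimes_comap hQ
  rw [← hq] at hw0
  have hwq : w ∉ q := by rw [hq]; exact hw
  have hu := IsLocalization.map_units (Localization.AtPrime q) (⟨w, hwq⟩ : q.primeCompl)
  rw [Ideal.mem_comap, Ideal.mem_bot]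
  refine hu.mul_right_eq_zero.1 ?_
  rw [← map_mul, hw0 a ha, map_zero]

theorem isArtinianRing_and_isReduced_tensorProduct_residueField {S B : Type u} [CommRing S]
    [CommRing B] [Algebra S B] (h : IsGluedSubring S B) [IsReduced B] [IsNoetherianRing B]
    [IsLocalRing B] (q : Ideal S) [q.IsPrime] :
    IsArtinianRing (B ⊗[S] q.ResidueField) ∧ IsReduced (B ⊗[S] q.ResidueField) := by
  obtain ⟨Q, hQ, hqQ⟩ | ⟨s, hsp, hs⟩ := h.exists_eq_comap_or_exists_mem q
  · have hfield := h.isField_localization hQ q hqQ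
    have hbij : Function.Bijective
        (IsScalarTower.toAlgHom S (Localization.AtPrime q) q.ResidueField) := by
      letI := hfield.toField
      refine ⟨?_, IsLocalRing.residue_surjective⟩
      exact (IsLocalRing.residue (Localization.AtPrime q)).injective
    have : IsLocalization q.primeCompl q.ResidueField :=
      IsLocalization.isLocalization_of_algEquiv q.primeCompl (AlgEquiv.ofBijective _ hbij)
    have hloc : IsLocalization (Algebra.algebraMapSubmonoid B q.primeCompl)
      (B ⊗[S] q.ResidueField) := inferInstance
    have hnoeth : IsNoetherianRing (B ⊗[S] q.ResidueField) :=
      IsLocalization.isNoetherianRing (Algebra.algebraMapSubmonoid B q.primeCompl) _ ‹_›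
    have hred : IsReduced (B ⊗[S] q.ResidueField) :=
      isReduced_localizationPreserves (Algebra.algebraMapSubmonoid B q.primeCompl)
        (B ⊗[S] q.ResidueField) ‹_›
    have hmin : ∀ (J : Ideal (B ⊗[S] q.ResidueField)) [J.IsPrime],
        J.comap (algebraMap B _) ∈ minimalPrimes B := by
      intro J hJ
      by_contra hc
      obtain ⟨t, htJ, ht⟩ := exists_mem_nonZeroDivisors_of_notMem_minimalPrimes _ hc
      obtain ⟨s, hsJ, hs⟩ := h.exists_mem_comap htJ ht
      have hsq : s ∈ q := by
        by_contra hsq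
        have hu := IsLocalization.map_units (B ⊗[S] q.ResidueField)
          (⟨algebraMap S B s, s, hsq, rfl⟩ : Algebra.algebraMapSubmonoid B q.primeCompl)
        exact hJ.ne_top (J.eq_top_of_isUnit_mem hsJ hu)
      rw [hqQ] at hsq
      exact notMem_nonZeroDivisors_of_mem_mem_minimalPrimes
        (show algebraMap S B s ∈ Q from hsq) hQ hs
    have hdim : Ring.KrullDimLE 0 (B ⊗[S] q.ResidueField) := by
      refine Ring.krullDimLE_zero_iff.2 fun J hJ ↦ ?_
      obtain ⟨J', hJ', hle⟩ := Ideal.exists_le_maximal J hJ.ne_top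
      have hJp := hJ'.isPrime
      have h1 := hmin J
      have h2 := hmin J'
      have h3 : J'.comap (algebraMap B (B ⊗[S] q.ResidueField)) ≤ J.comap (algebraMap B _) :=
        h2.2 ⟨h1.1.1, bot_le⟩ (Ideal.comap_mono hle)
      have h4 : J' ≤ J := by
        rw [← IsLocalization.map_under (Algebra.algebraMapSubmonoid B q.primeCompl) _ J',
          ← IsLocalization.map_under (Algebra.algebraMapSubmonoid B q.primeCompl) _ J]
        exact Ideal.map_mono h3
      rwa [le_antisymm hle h4]
    exact ⟨IsNoetherianRing.isArtinianRing_of_krullDimLE_zero, hred⟩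
  · refine isArtinianRing_and_isReduced_of_surjective
      (Algebra.TensorProduct.includeRight : q.ResidueField →ₐ[S] B ⊗[S] q.ResidueField).toRingHom
      fun z ↦ ?_
    induction z with
    | zero => exact ⟨0, map_zero _⟩
    | add x y hx hy =>
      obtain ⟨x, rfl⟩ := hx
      obtain ⟨y, rfl⟩ := hy
      exact ⟨x + y, map_add _ _ _⟩
    | tmul b l =>
      obtain ⟨a, c, rfl⟩ := h.approx _ hs b
      refine ⟨a • l, ?_⟩
      have h0 : algebraMap S q.ResidueField s = 0 := Ideal.algebraMap_residueField_eq_zero.2 hsp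
      have h1 : (algebraMap S B s * c) ⊗ₜ[S] l = 0 := by
        rw [← Algebra.smul_def, smul_tmul, Algebra.smul_def, h0, zero_mul, tmul_zero]
      rw [add_tmul, h1, add_zero, Algebra.algebraMap_eq_smul_one, smul_tmul]
      rfl

section FaithfullyFlat

variable {S B : Type u} [CommRing S] [CommRing B] [Algebra S B]

theorem nonempty_algEquiv_adicCompletion (h : IsGluedSubring S B) [IsLocalRing B] [IsLocalRing S]
    (hM : (∃ t ∈ maximalIdeal B, t ∈ nonZeroDivisors B) ∨ Function.Surjective (algebraMap S B)) :
    Nonempty (AdicCompletion (maximalIdeal S) S ≃ₐ[S] AdicCompletion (maximalIdeal B) B) :=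
  AdicCompletion.exists_algEquiv _ _ (h.comap_maximalIdeal_pow hM)
    (h.exists_sub_mem_maximalIdeal_pow hM)

theorem faithfullyFlat (h : IsGluedSubring S B) [IsReduced B] [IsNoetherianRing B] [IsLocalRing B]
    [IsLocalRing S]
    (hM : (∃ t ∈ maximalIdeal B, t ∈ nonZeroDivisors B) ∨ Function.Surjective (algebraMap S B)) :
    Module.FaithfullyFlat S B := by
  have := h.isNoetherianRing
  have := h.isLocalHom
  obtain ⟨e⟩ := h.nonempty_algEquiv_adicCompletion hM
  have : Module.Flat S (AdicCompletion (maximalIdeal B) B) :=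
    Module.Flat.of_linearEquiv e.symm.toLinearEquiv
  have : IsLocalHom (algebraMap B (AdicCompletion (maximalIdeal B) B)) := by
    infer_instance
  have : Module.FaithfullyFlat B (AdicCompletion (maximalIdeal B) B) :=
    Module.FaithfullyFlat.of_flat_of_isLocalHom
  have : Module.Flat S B :=
    Module.Flat.of_flat_of_faithfullyFlat S B (AdicCompletion (maximalIdeal B) B)
  exact Module.FaithfullyFlat.of_flat_of_isLocalHom

end FaithfullyFlat

section Fibers

variable {S B : Type u} [CommRing S] [CommRing B] [Algebra S B]

/-- The fibers of a glued subring remain regular after finitely generated extensions. -/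
theorem isRegularRing_tensorProduct (h : IsGluedSubring S B) [Algebra ℚ S] [IsReduced B]
    [IsNoetherianRing B] [IsLocalRing B] (L : Type u) [Field L] [Algebra S L]
    [Algebra.EssFiniteType S L] : IsRegularRing (L ⊗[S] B) := by
  obtain ⟨p, hp, hpk⟩ : ∃ p : Ideal S, p.IsPrime ∧ ∀ x, x ∈ p ↔ algebraMap S L x = 0 :=
    ⟨RingHom.ker (algebraMap S L), RingHom.ker_isPrime _, fun x ↦ Iff.rfl⟩
  obtain ⟨_, _⟩ := exists_algebra_residueField_ker S L p hpk
  obtain ⟨h1, h2⟩ := h.isArtinianRing_and_isReduced_tensorProduct_residueField p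
  have := IsRegularRing.of_isArtinianRing_of_isReduced (B ⊗[S] p.ResidueField)
  have : IsRegularRing (p.ResidueField ⊗[S] B) :=
    IsRegularRing.of_ringEquiv (Algebra.TensorProduct.comm S B p.ResidueField).toRingEquiv
  have : CharZero p.ResidueField :=
    charZero_of_injective_ringHom
      ((algebraMap S p.ResidueField).comp (algebraMap ℚ S)).injective
  have : Algebra.EssFiniteType p.ResidueField L := Algebra.EssFiniteType.of_comp S _ _
  have := isRegularRing_tensorProduct_of_essFiniteType p.ResidueField L (p.ResidueField ⊗[S] B)
  exact IsRegularRing.of_ringEquiv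
    (Algebra.TensorProduct.cancelBaseChange S p.ResidueField L L B).toRingEquiv

theorem isArtinianRing_and_isReduced_tensorProduct (h : IsGluedSubring S B) [Algebra ℚ S]
    [IsReduced B] [IsNoetherianRing B] [IsLocalRing B] (L : Type u) [Field L] [Algebra S L]
    (hL : FracFinite S L) : IsArtinianRing (B ⊗[S] L) ∧ IsReduced (B ⊗[S] L) := by
  obtain ⟨p, hp, hpk⟩ : ∃ p : Ideal S, p.IsPrime ∧ ∀ x, x ∈ p ↔ algebraMap S L x = 0 :=
    ⟨RingHom.ker (algebraMap S L), RingHom.ker_isPrime _, fun x ↦ Iff.rfl⟩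
  obtain ⟨_, _⟩ := exists_algebra_residueField_ker S L p hpk
  have : Module.Finite p.ResidueField L := (hL.tower_top _).finite
  have : Algebra.EssFiniteType S L := Algebra.EssFiniteType.comp S p.ResidueField L
  obtain ⟨h1, h2⟩ := h.isArtinianRing_and_isReduced_tensorProduct_residueField p
  have h3 : IsArtinianRing (p.ResidueField ⊗[S] B) :=
    (Algebra.TensorProduct.comm S B p.ResidueField).surjective.isArtinianRing
      (f := (Algebra.TensorProduct.comm S B p.ResidueField).toRingEquiv.toRingHom)
  have h4 : IsArtinianRing ((p.ResidueField ⊗[S] B) ⊗[p.ResidueField] L) :=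
    .of_finite (p.ResidueField ⊗[S] B) _
  let e := ((Algebra.TensorProduct.comm p.ResidueField (p.ResidueField ⊗[S] B) L).toRingEquiv.trans
    (Algebra.TensorProduct.cancelBaseChange S p.ResidueField p.ResidueField L B).toRingEquiv).trans
    (Algebra.TensorProduct.comm S L B).toRingEquiv
  have h5 : IsArtinianRing (B ⊗[S] L) := e.surjective.isArtinianRing (f := e.toRingHom)
  have := h.isRegularRing_tensorProduct L
  have : IsRegularRing (B ⊗[S] L) :=
    IsRegularRing.of_ringEquiv (Algebra.TensorProduct.comm S L B).toRingEquiv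
  exact ⟨h5, isReduced_of_isArtinianRing_of_isRegularRing _⟩

theorem isJ2Ring (h : IsGluedSubring S B) [Algebra ℚ S] [IsReduced B]
    [IsNoetherianRing B] [IsLocalRing B] [Module.FaithfullyFlat S B] (hB : IsJ2Ring B) :
    IsJ2Ring S := by
  intro C _ _ hC
  have := h.isNoetherianRing
  have : IsNoetherianRing C := Algebra.FiniteType.isNoetherianRing S C
  have : IsNoetherianRing (B ⊗[S] C) := Algebra.FiniteType.isNoetherianRing B _
  letI e := (Algebra.TensorProduct.comm S B C).toRingEquiv
  letI : Algebra B (C ⊗[S] B) := Algebra.TensorProduct.rightAlgebra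
  let e' : B ⊗[S] C ≃ₐ[B] C ⊗[S] B := AlgEquiv.ofRingEquiv (f := e) fun b ↦ rfl
  have : IsNoetherianRing (C ⊗[S] B) := isNoetherianRing_of_ringEquiv _ e
  have hft : Algebra.FiniteType B (C ⊗[S] B) :=
    Algebra.FiniteType.of_surjective e'.toAlgHom e'.surjective
  have hopen := hB (C ⊗[S] B) hft
  simp only [isRegularLocalRingOld_iff] at hopen ⊢
  refine isOpen_regularLocus_of_faithfullyFlat (R := C) (R' := C ⊗[S] B) (fun c hc ↦ ?_) hopen
  have : Algebra.EssFiniteType S c.ResidueField := Algebra.EssFiniteType.comp S C c.ResidueField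
  have := h.isRegularRing_tensorProduct c.ResidueField
  exact IsRegularRing.of_ringEquiv
    (Algebra.TensorProduct.cancelBaseChange S C C c.ResidueField B).symm.toRingEquiv

end Fibers

section Localization

variable {S B : Type u} [CommRing S] [CommRing B] [Algebra S B] {Sq BP : Type u} [CommRing Sq]
  [CommRing BP] [Algebra S Sq] [Algebra B BP] [Algebra S BP] [IsScalarTower S B BP]

theorem comap_maximalIdeal_pow_localization (h : IsGluedSubring S B) {q : Ideal S} {P : Ideal B}
    [q.IsPrime] [P.IsPrime] (hP : q.map (algebraMap S B) = P) {s : S} (hsq : s ∈ q)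
    (hs : algebraMap S B s ∈ nonZeroDivisors B) [IsLocalization.AtPrime Sq q]
    [IsLocalization.AtPrime BP P] [IsLocalRing Sq] [IsLocalRing BP] [Algebra Sq BP]
    [IsScalarTower S Sq BP] (n : ℕ) :
    ((maximalIdeal BP) ^ n).comap (algebraMap Sq BP) = maximalIdeal Sq ^ n := by
  have hq : P.comap (algebraMap S B) = q := by rw [← hP, h.comap_map hsq hs]
  have hmP : maximalIdeal BP = P.map (algebraMap B BP) :=
    (IsLocalization.AtPrime.map_eq_maximalIdeal P BP).symm
  have hmq : maximalIdeal Sq = q.map (algebraMap S Sq) :=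
    (IsLocalization.AtPrime.map_eq_maximalIdeal q Sq).symm
  have hsP : algebraMap S B s ∈ P := by rw [← hP]; exact Ideal.mem_map_of_mem _ hsq
  rw [hmP, hmq, ← Ideal.map_pow, ← Ideal.map_pow]
  apply le_antisymm
  · intro x hx
    obtain ⟨a, d, rfl⟩ := IsLocalization.exists_mk'_eq q.primeCompl x
    have ha : algebraMap B BP (algebraMap S B a) ∈ (P ^ n).map (algebraMap B BP) := by
      have := Ideal.mul_mem_left _ (algebraMap Sq BP (algebraMap S Sq d))
        (Ideal.mem_comap.1 hx)
      rwa [← map_mul, IsLocalization.mk'_spec', ← IsScalarTower.algebraMap_apply,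
        IsScalarTower.algebraMap_apply S B BP] at this
    obtain ⟨t, htP, ht⟩ :=
      (IsLocalization.algebraMap_mem_map_algebraMap_iff P.primeCompl BP _ _).1 ha
    obtain ⟨d', c, hc⟩ := h.approx _ (pow_mem hs (n + 1)) t
    have hd' : d' ∉ q := by
      rw [← hq]
      intro hd'
      refine htP ?_
      rw [hc]
      exact add_mem hd' (Ideal.mul_mem_right _ _ (Ideal.pow_mem_of_mem _ hsP _ n.succ_pos))
    have hmem : algebraMap S B (d' * a) ∈ P ^ n := by
      have h1 : algebraMap S B (d' * a) = t * algebraMap S B a -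
          (algebraMap S B s) ^ n * (algebraMap S B s * c * algebraMap S B a) := by
        rw [hc, map_mul]; ring
      rw [h1]
      exact sub_mem ht (Ideal.mul_mem_right _ _ (Ideal.pow_mem_pow hsP n))
    rw [← hP, ← Ideal.map_pow, ← Ideal.mem_comap, h.comap_map (Ideal.pow_mem_pow hsq n)
      (by rw [map_pow]; exact pow_mem hs n)] at hmem
    rw [IsLocalization.mk'_mem_map_algebraMap_iff]
    exact ⟨d', hd', hmem⟩
  · rw [Ideal.map_le_iff_le_comap, Ideal.comap_comap, ← IsScalarTower.algebraMap_eq,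
      IsScalarTower.algebraMap_eq S B BP, ← Ideal.comap_comap, ← Ideal.map_le_iff_le_comap,
      Ideal.map_pow, hP]
    exact Ideal.le_comap_map

theorem exists_sub_mem_maximalIdeal_pow_localization (h : IsGluedSubring S B) {q : Ideal S}
    {P : Ideal B}
    [q.IsPrime] [P.IsPrime] (hP : q.map (algebraMap S B) = P) {s : S} (hsq : s ∈ q)
    (hs : algebraMap S B s ∈ nonZeroDivisors B) [IsLocalization.AtPrime Sq q]
    [IsLocalization.AtPrime BP P] [IsLocalRing BP] [Algebra Sq BP]
    [IsScalarTower S Sq BP] (n : ℕ) (x : BP) :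
    ∃ a, algebraMap Sq BP a - x ∈ maximalIdeal BP ^ n := by
  have hq : P.comap (algebraMap S B) = q := by rw [← hP, h.comap_map hsq hs]
  have hmP : maximalIdeal BP = P.map (algebraMap B BP) :=
    (IsLocalization.AtPrime.map_eq_maximalIdeal P BP).symm
  have hsP : algebraMap S B s ∈ P := by rw [← hP]; exact Ideal.mem_map_of_mem _ hsq
  obtain ⟨b, ⟨t, ht⟩, rfl⟩ := IsLocalization.exists_mk'_eq P.primeCompl x
  obtain ⟨a, c, hc⟩ := h.approx _ (pow_mem hs (n + 1)) b
  obtain ⟨d, e, he⟩ := h.approx _ (pow_mem hs (n + 1)) t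
  have hd : d ∉ q := by
    rw [← hq]
    intro hd
    refine ht ?_
    rw [he]
    exact add_mem hd (Ideal.mul_mem_right _ _ (Ideal.pow_mem_of_mem _ hsP _ n.succ_pos))
  refine ⟨IsLocalization.mk' Sq a (⟨d, hd⟩ : q.primeCompl), ?_⟩
  have hud : IsUnit (algebraMap B BP (algebraMap S B d)) :=
    IsLocalization.map_units BP (⟨_, fun hd' ↦ hd (hq.le hd')⟩ : P.primeCompl)
  have hut : IsUnit (algebraMap B BP t) := IsLocalization.map_units BP (⟨t, ht⟩ : P.primeCompl)
  have h1 : algebraMap B BP (algebraMap S B d) *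
      algebraMap Sq BP (IsLocalization.mk' Sq a (⟨d, hd⟩ : q.primeCompl)) =
      algebraMap B BP (algebraMap S B a) := by
    rw [← IsScalarTower.algebraMap_apply S B BP, IsScalarTower.algebraMap_apply S Sq BP,
      ← map_mul, IsLocalization.mk'_spec' Sq a (⟨d, hd⟩ : q.primeCompl),
      ← IsScalarTower.algebraMap_apply, ← IsScalarTower.algebraMap_apply]
  have h2 : algebraMap B BP t * IsLocalization.mk' BP b (⟨t, ht⟩ : P.primeCompl) =
      algebraMap B BP b := IsLocalization.mk'_spec' BP b (⟨t, ht⟩ : P.primeCompl)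
  rw [← Ideal.unit_mul_mem_iff_mem _ (hud.mul hut)]
  have h3 : algebraMap B BP (algebraMap S B d) * algebraMap B BP t *
      (algebraMap Sq BP (IsLocalization.mk' Sq a (⟨d, hd⟩ : q.primeCompl)) -
        IsLocalization.mk' BP b (⟨t, ht⟩ : P.primeCompl)) =
      algebraMap B BP ((algebraMap S B s) ^ n * (algebraMap S B s * (b * e - c * t))) := by
    have h4 : (algebraMap S B s) ^ n * (algebraMap S B s * (b * e - c * t)) =
        algebraMap S B a * t - algebraMap S B d * b := by
      have ha : algebraMap S B a = b - algebraMap S B s ^ (n + 1) * c := by rw [hc]; ring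
      have hd : algebraMap S B d = t - algebraMap S B s ^ (n + 1) * e := by rw [he]; ring
      rw [ha, hd]; ring
    rw [h4, map_sub, map_mul, map_mul, ← h1, ← h2]
    ring
  rw [h3, hmP, ← Ideal.map_pow]
  exact Ideal.mem_map_of_mem _ (Ideal.mul_mem_right _ _ (Ideal.pow_mem_pow hsP n))

theorem nonempty_algEquiv_adicCompletion_localization (h : IsGluedSubring S B) {q : Ideal S}
    {P : Ideal B} [q.IsPrime] [P.IsPrime] (hP : q.map (algebraMap S B) = P) {s : S} (hsq : s ∈ q)
    (hs : algebraMap S B s ∈ nonZeroDivisors B) [IsLocalization.AtPrime Sq q]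
    [IsLocalization.AtPrime BP P] [IsLocalRing Sq] [IsLocalRing BP] :
    Nonempty (AdicCompletion (maximalIdeal Sq) Sq ≃ₐ[S] AdicCompletion (maximalIdeal BP) BP) := by
  have hq : P.comap (algebraMap S B) = q := by rw [← hP, h.comap_map hsq hs]
  let f : Sq →ₐ[S] BP := IsLocalization.liftAlgHom (M := q.primeCompl) (f := Algebra.ofId S BP)
    fun y ↦ by
      change IsUnit (algebraMap S BP y)
      rw [IsScalarTower.algebraMap_apply S B BP]
      exact IsLocalization.map_units BP (⟨_, fun hy ↦ y.2 (hq.le hy)⟩ : P.primeCompl)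
  letI := f.toRingHom.toAlgebra
  haveI : IsScalarTower S Sq BP := .of_algebraMap_eq fun r ↦ (f.commutes r).symm
  obtain ⟨e⟩ := AdicCompletion.exists_algEquiv (maximalIdeal Sq) (maximalIdeal BP)
    (h.comap_maximalIdeal_pow_localization hP hsq hs)
    (h.exists_sub_mem_maximalIdeal_pow_localization hP hsq hs)
  have : IsScalarTower S Sq (AdicCompletion (maximalIdeal BP) BP) := .of_algebraMap_eq fun r ↦ by
    rw [IsScalarTower.algebraMap_apply S BP (AdicCompletion (maximalIdeal BP) BP),
      IsScalarTower.algebraMap_apply Sq BP (AdicCompletion (maximalIdeal BP) BP),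
      ← IsScalarTower.algebraMap_apply S Sq BP]
  exact ⟨e.restrictScalars S⟩

end Localization

section GRing

theorem isRegularRing_tensorProduct_adicCompletion_of_isField {S F L : Type u} [CommRing S]
    [CommRing F] [Field L] [Algebra S F] [Algebra S L] [Algebra F L] [IsScalarTower S F L]
    [IsLocalRing F] (hF : IsField F) (M : Submonoid S) [IsLocalization M F] :
    IsRegularRing (L ⊗[S] AdicCompletion (maximalIdeal F) F) := by
  have hm : maximalIdeal F = ⊥ := IsLocalRing.isField_iff_maximalIdeal_eq.1 hF
  rw [hm]
  let e1 : L ⊗[S] F ≃ₐ[S] L ⊗[S] AdicCompletion (⊥ : Ideal F) F :=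
    Algebra.TensorProduct.congr AlgEquiv.refl
      ((AdicCompletion.ofAlgEquiv (⊥ : Ideal F)).restrictScalars S)
  let e2 := (IsLocalization.algebraTensorEquiv M F L F).toRingEquiv
  let e3 := (Algebra.TensorProduct.rid F F L).toRingEquiv
  exact IsRegularRing.of_ringEquiv (e3.symm.trans (e2.trans e1.toRingEquiv))

theorem isGRing {S B : Type u} [CommRing S] [CommRing B] [Algebra S B]
    (h : IsGluedSubring S B) [Algebra ℚ S] [IsReduced B]
    [IsNoetherianRing B] [IsLocalRing B] (hB : IsGRing B) : IsGRing S := by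
  refine IsGRing.of_forall fun q _ L _ _ _ _ hL ↦ ?_
  obtain ⟨Q, hQ, hqQ⟩ | ⟨s, hsq, hs⟩ := h.exists_eq_comap_or_exists_mem q
  · exact isRegularRing_tensorProduct_adicCompletion_of_isField
      (h.isField_localization hQ q hqQ) q.primeCompl
  · obtain ⟨P, hP⟩ : ∃ P, P = q.map (algebraMap S B) := ⟨_, rfl⟩
    have : P.IsPrime := hP ▸ h.isPrime_map hsq hs
    obtain ⟨e⟩ := h.nonempty_algEquiv_adicCompletion_localization hP.symm hsq hs
      (Sq := Localization.AtPrime q) (BP := Localization.AtPrime P)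
    obtain ⟨h1, h2⟩ := h.isArtinianRing_and_isReduced_tensorProduct L hL
    have := isRegularRing_tensorProduct_of_isArtinianRing S B L
      (AdicCompletion (maximalIdeal (Localization.AtPrime P)) (Localization.AtPrime P)) hL
      fun L' _ _ hL' ↦ hB.isRegularRing_tensorProduct P L' hL'
    exact IsRegularRing.of_ringEquiv
      (Algebra.TensorProduct.congr (AlgEquiv.refl (R := S) (A₁ := L)) e.symm).toRingEquiv

end GRing

theorem isQuasiExcellentRing {S B : Type u} [CommRing S] [CommRing B] [Algebra S B]
    (h : IsGluedSubring S B) [Algebra ℚ S] [IsReduced B] [IsNoetherianRing B] [IsLocalRing B]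
    [IsLocalRing S]
    (hM : (∃ t ∈ maximalIdeal B, t ∈ nonZeroDivisors B) ∨ Function.Surjective (algebraMap S B))
    (hB : IsQuasiExcellentRing B) : IsQuasiExcellentRing S := by
  have := h.faithfullyFlat hM
  exact ⟨h.isNoetherianRing, h.isGRing hB.2.1, h.isJ2Ring hB.2.2⟩

end IsGluedSubring

section Construction

open Cardinal Polynomial

/-- The image of `x` modulo the ideal `Q` is transcendental over the image of the subring `R`. -/
def TranscendentalMod {B : Type u} [CommRing B] (R : Subring B) (Q : Ideal B) (x : B) : Prop :=
  ∀ f : B[X], (∀ n, f.coeff n ∈ R) → f.eval x ∈ Q → ∀ n, f.coeff n ∈ Q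

/-- Elements of `R` lying in `Q` also lie in `Q'`, for `Q` and `Q'` in the same class `C i`. -/
def IsGluedAlong {B : Type u} [CommRing B] {ι : Type*} (C : ι → Set (Ideal B)) (R : Subring B) :
    Prop :=
  ∀ i, ∀ Q ∈ C i, ∀ Q' ∈ C i, ∀ r ∈ R, r ∈ Q → r ∈ Q'

variable {B : Type u} [CommRing B]

theorem TranscendentalMod.mono {R R' : Subring B} {Q : Ideal B} {x : B}
    (h : TranscendentalMod R Q x) (hle : R' ≤ R) : TranscendentalMod R' Q x :=
  fun f hf ↦ h f fun n ↦ hle (hf n)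

theorem TranscendentalMod.notMem {R : Subring B} {Q : Ideal B} (hQ : Q ≠ ⊤) {x : B}
    (h : TranscendentalMod R Q x) : x ∉ Q := by
  intro hx
  have := h X (fun n ↦ by rw [coeff_X]; split_ifs; exacts [R.one_mem, R.zero_mem])
    (by simpa using hx) 1
  exact hQ ((Ideal.eq_top_iff_one _).2 (by simpa using this))

/-- Generic elements of a coset are transcendental over small subrings modulo prime ideals. -/
theorem exists_forall_transcendentalMod [IsLocalRing B] (hk : ℵ₀ < #(ResidueField B))
    (R : Subring B) (hR : #R < #(ResidueField B)) {T : Set (Ideal B)} (hT : T.Finite)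
    (hprime : ∀ Q ∈ T, Q.IsPrime) (b t : B) (ht : ∀ Q ∈ T, t ∉ Q) :
    ∃ y, ∀ Q ∈ T, TranscendentalMod R Q (b + t * y) := by
  obtain ⟨σ, hσ⟩ : ∃ σ : ResidueField B → B, ∀ k, residue B (σ k) = k :=
    ⟨_, Function.surjInv_eq residue_surjective⟩
  let bad (i : T × R[X]) : Set (ResidueField B) :=
    {k | (∃ n, (i.2.coeff n : B) ∉ (i.1 : Ideal B)) ∧
      (i.2.map R.subtype).eval (b + t * σ k) ∈ (i.1 : Ideal B)}
  have hbad (i : T × R[X]) : (bad i).Finite := by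
    obtain ⟨⟨Q, hQ⟩, f⟩ := i
    have := hprime Q hQ
    by_cases hf : ∃ n, (f.coeff n : B) ∉ Q
    · let g := f.map ((Ideal.Quotient.mk Q).comp R.subtype)
      have hg : g ≠ 0 := by
        obtain ⟨n, hn⟩ := hf
        intro h0
        have h1 : g.coeff n = 0 := by rw [h0, coeff_zero]
        rw [coeff_map] at h1
        exact hn (Ideal.Quotient.eq_zero_iff_mem.1 h1)
      refine Set.Finite.of_finite_image (f := fun k ↦ Ideal.Quotient.mk Q (b + t * σ k))
        ((finite_setOfPred_isRoot hg).subset ?_) ?_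
      · rintro _ ⟨k, ⟨-, hk⟩, rfl⟩
        have h1 := Ideal.Quotient.eq_zero_iff_mem.2 hk
        rw [← eval₂_at_apply, ← eval_map, Polynomial.map_map] at h1
        exact h1
      · intro k _ k' _ hkk'
        have h1 := Ideal.Quotient.eq.1 hkk'
        have h2 : t * (σ k - σ k') ∈ Q := by convert h1 using 1; ring
        have h3 := le_maximalIdeal this.ne_top ((this.mem_or_mem h2).resolve_left (ht Q hQ))
        rw [← residue_eq_zero_iff, map_sub, hσ, hσ, sub_eq_zero] at h3
        exact h3
    · exact Set.finite_empty.subset fun k hk ↦ (hf hk.1).elim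
  have hcard : #(⋃ i, bad i : Set (ResidueField B)) < #(ResidueField B) := by
    refine (mk_iUnion_le_sum_mk.trans (sum_le_sum _ (fun _ ↦ ℵ₀)
      fun i ↦ (hbad i).lt_aleph0.le)).trans_lt ?_
    rw [sum_const', mk_prod, lift_id, lift_id]
    refine mul_lt_of_lt hk.le (mul_lt_of_lt hk.le (hT.lt_aleph0.trans hk) ?_) hk
    exact Polynomial.cardinalMk_le_max.trans_lt (max_lt hR hk)
  obtain ⟨k, hk'⟩ : ∃ k, k ∉ ⋃ i, bad i := by
    by_contra! hc
    rw [Set.eq_univ_of_forall hc, mk_univ] at hcard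
    exact hcard.false
  refine ⟨σ k, fun Q hQ f hf hfx n ↦ ?_⟩
  by_contra hn
  have hfR : (f.coeffs : Set B) ⊆ R := by
    intro c hc
    obtain ⟨n, -, rfl⟩ := mem_coeffs_iff.1 hc
    exact hf n
  refine hk' (Set.mem_iUnion.2 ⟨(⟨Q, hQ⟩, f.toSubring R hfR), ⟨n, ?_⟩, ?_⟩)
  · rwa [coeff_toSubring]
  · rwa [map_toSubring]

theorem mk_closure_union_lt (R : Subring B) (A : Set B) {c : Cardinal.{u}} (hc : ℵ₀ < c)
    (hR : #R < c) (hA : #A < c) : #(Subring.closure ((R : Set B) ∪ A)) < c := by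
  have hle : Subring.closure ((R : Set B) ∪ A) ≤ (Algebra.adjoin R A).toSubring :=
    Subring.closure_le.2 (Set.union_subset
      (fun r hr ↦ (Algebra.adjoin R A).algebraMap_mem ⟨r, hr⟩) Algebra.subset_adjoin)
  refine (mk_le_mk_of_subset hle).trans_lt ?_
  exact (Algebra.cardinalMk_adjoin_le R A).trans_lt (max_lt (max_lt hR hA) hc)

theorem exists_eval_eq_of_mem_closure {R : Subring B} {x r : B}
    (hr : r ∈ Subring.closure ((R : Set B) ∪ {x})) :
    ∃ f : B[X], (∀ n, f.coeff n ∈ R) ∧ f.eval x = r := by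
  have hle : Subring.closure ((R : Set B) ∪ {x}) ≤ (eval₂RingHom R.subtype x).range := by
    refine Subring.closure_le.2 (Set.union_subset (fun r hr ↦ ⟨C ⟨r, hr⟩, by simp⟩) ?_)
    rintro _ rfl
    exact ⟨X, by simp⟩
  obtain ⟨f, rfl⟩ := hle hr
  exact ⟨f.map R.subtype, fun n ↦ by simp, by simp [eval_map]⟩

/-- Adjoining an element that is generic along some classes and zero along the others preserves
the gluing. -/
theorem IsGluedAlong.closure_union_singleton {ι : Type*} {C : ι → Set (Ideal B)} {R : Subring B}
    (hR : IsGluedAlong C R) {x : B}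
    (hx : ∀ i, (∀ Q ∈ C i, TranscendentalMod R Q x) ∨ ∀ Q ∈ C i, x ∈ Q) :
    IsGluedAlong C (Subring.closure ((R : Set B) ∪ {x})) := by
  intro i Q hQ Q' hQ' r hr hrQ
  obtain ⟨f, hf, rfl⟩ := exists_eval_eq_of_mem_closure hr
  obtain h | h := hx i
  · rw [eval_eq_sum_range]
    exact sum_mem fun n _ ↦
      Ideal.mul_mem_right _ _ (hR i Q hQ Q' hQ' _ (hf n) (h Q hQ f hf hrQ n))
  · have key : f.eval x = f.divX.eval x * x + f.coeff 0 := by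
      conv_lhs => rw [← divX_mul_X_add f]
      simp
    rw [key] at hrQ ⊢
    rw [Ideal.add_mem_iff_right _ (Ideal.mul_mem_left _ _ (h Q hQ))] at hrQ
    exact add_mem (Ideal.mul_mem_left _ _ (h Q' hQ')) (hR i Q hQ Q' hQ' _ (hf 0) hrQ)

theorem isGluedAlong_rat [Algebra ℚ B] {ι : Type*} {C : ι → Set (Ideal B)}
    (hC : ∀ i, ∀ Q ∈ C i, Q ≠ ⊤) : IsGluedAlong C (algebraMap ℚ B).range := by
  rintro i Q hQ Q' - _ ⟨a, rfl⟩ ha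
  by_cases h0 : a = 0
  · simp [h0]
  · exact (hC i Q hQ (Q.eq_top_of_isUnit_mem ha ((isUnit_iff_ne_zero.2 h0).map _))).elim

end Construction

section Construction

open Cardinal

variable {B : Type u} [CommRing B]

/-- An element vanishing exactly along a prescribed set of minimal primes. -/
theorem exists_mem_iff_of_subset_minimalPrimes [IsNoetherianRing B] {T : Set (Ideal B)}
    (hT : T ⊆ minimalPrimes B) : ∃ v : B, ∀ Q ∈ minimalPrimes B, v ∈ Q ↔ Q ∈ T := by
  have hfin := minimalPrimes.finite_of_isNoetherianRing B
  have hTfin := hfin.subset hT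
  obtain ⟨v, hv, hv'⟩ := exists_mem_forall_notMem_of_finite (hTfin.toFinset.inf id)
    (T := minimalPrimes B \ T) (hfin.subset Set.sdiff_subset) (fun Q hQ ↦ hQ.1.1.1) (by
      rintro Q ⟨hQ, hQT⟩ hle
      obtain ⟨Q', hQ', hle'⟩ := (Ideal.IsPrime.inf_le' hQ.1.1).1 hle
      have hQ'T : Q' ∈ T := by simpa using hQ'
      have : Q' = Q := le_antisymm hle' (hQ.2 ⟨(hT hQ'T).1.1, bot_le⟩ hle')
      exact hQT (this ▸ hQ'T))
  refine ⟨v, fun Q hQ ↦ ⟨fun hvQ ↦ ?_, fun hQT ↦ ?_⟩⟩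
  · by_contra hQT
    exact hv' Q ⟨hQ, hQT⟩ hvQ
  · exact Finset.inf_le (f := id) (hTfin.mem_toFinset.2 hQT) hv

/-- A small glued subring containing elements that separate the classes. -/
theorem exists_isGluedAlong_separating [IsNoetherianRing B] [IsLocalRing B] [Algebra ℚ B]
    (hk : ℵ₀ < #(ResidueField B)) {ι : Type*} [Finite ι] {C : ι → Set (Ideal B)}
    (hCdisj : ∀ i j, i ≠ j → Disjoint (C i) (C j)) (hCmin : ∀ i, C i ⊆ minimalPrimes B) :
    ∃ R : Subring B, #R < #(ResidueField B) ∧ IsGluedAlong C R ∧ (algebraMap ℚ B).range ≤ R ∧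
      ∀ i, ∃ u ∈ R, ∀ j, ∀ Q ∈ C j, u ∈ Q ↔ j = i := by
  classical
  have := Fintype.ofFinite ι
  suffices h : ∀ s : Finset ι, ∃ R : Subring B, #R < #(ResidueField B) ∧ IsGluedAlong C R ∧
      (algebraMap ℚ B).range ≤ R ∧ ∀ i ∈ s, ∃ u ∈ R, ∀ j, ∀ Q ∈ C j, u ∈ Q ↔ j = i by
    simpa using h Finset.univ
  intro s
  induction s using Finset.induction_on with
  | empty =>
    refine ⟨_, ?_, isGluedAlong_rat fun i Q hQ ↦ (hCmin i hQ).1.1.ne_top, le_rfl, by simp⟩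
    refine lt_of_le_of_lt ?_ hk
    have : Countable (algebraMap ℚ B).range :=
      (algebraMap ℚ B).rangeRestrict_surjective.countable
    exact mk_le_aleph0
  | insert i s _ ih =>
    obtain ⟨R, hRcard, hR, hRQ, hRs⟩ := ih
    obtain ⟨v, hv⟩ := exists_mem_iff_of_subset_minimalPrimes (hCmin i)
    have hmem (j : ι) (hj : j ≠ i) (Q : Ideal B) (hQ : Q ∈ C j) : Q ∉ C i :=
      Set.disjoint_left.1 (hCdisj j i hj) hQ
    obtain ⟨y, hy⟩ := exists_forall_transcendentalMod hk R hRcard (T := minimalPrimes B \ C i)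
      ((minimalPrimes.finite_of_isNoetherianRing B).subset Set.sdiff_subset)
      (fun Q hQ ↦ hQ.1.1.1) 0 v (fun Q hQ hvQ ↦ hQ.2 ((hv Q hQ.1).1 hvQ))
    rw [zero_add] at hy
    have htr (j : ι) (hj : j ≠ i) (Q : Ideal B) (hQ : Q ∈ C j) : TranscendentalMod R Q (v * y) :=
      hy Q ⟨hCmin j hQ, hmem j hj Q hQ⟩
    have hzero (Q : Ideal B) (hQ : Q ∈ C i) : v * y ∈ Q :=
      Ideal.mul_mem_right _ _ ((hv Q (hCmin i hQ)).2 hQ)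
    have hle : R ≤ Subring.closure ((R : Set B) ∪ {v * y}) := fun r hr ↦
      Subring.subset_closure (Or.inl hr)
    refine ⟨Subring.closure ((R : Set B) ∪ {v * y}), mk_closure_union_lt _ _ hk hRcard ?_,
      hR.closure_union_singleton fun j ↦ ?_, hRQ.trans hle, fun j hj ↦ ?_⟩
    · exact ((Set.finite_singleton _).lt_aleph0).trans hk
    · by_cases hj : j = i
      · exact Or.inr (hj ▸ hzero)
      · exact Or.inl (htr j hj)
    · obtain rfl | hj := Finset.mem_insert.1 hj
      · refine ⟨v * y, Subring.subset_closure (Or.inr rfl), fun l Q hQ ↦ ⟨fun h ↦ ?_, ?_⟩⟩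
        · by_contra hl
          exact (htr l hl Q hQ).notMem (hCmin l hQ).1.1.ne_top h
        · rintro rfl
          exact hzero Q hQ
      · obtain ⟨u, hu, hu'⟩ := hRs j hj
        exact ⟨u, hle hu, hu'⟩

/-- Choosing elements recursively along a well-order, each generic over the previous ones. -/
theorem exists_forall_of_forall_exists {I α : Type*} [LinearOrder I] [WellFoundedLT I]
    (p : I → Set α → α → Prop) (h : ∀ i A, ∃ y, p i A y) :
    ∃ x : I → α, ∀ i, p i (x '' Set.Iio i) (x i) := by
  choose g hg using h
  let x : I → α := (wellFounded_lt (α := I)).fix fun i ih ↦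
    g i (Set.range fun j : Set.Iio i ↦ ih j j.2)
  refine ⟨x, fun i ↦ ?_⟩
  have hx : x i = g i (x '' Set.Iio i) := by
    rw [Set.image_eq_range]
    exact (wellFounded_lt (α := I)).fix_eq _ i
  rw [hx]
  exact hg _ _

/-- A glued subring stays glued after adjoining successively generic elements. -/
theorem IsGluedAlong.closure_union_range {ι : Type*} {C : ι → Set (Ideal B)} {R : Subring B}
    (hR : IsGluedAlong C R) {I : Type*} [LinearOrder I] (x : I → B)
    (hx : ∀ a, ∀ i, ∀ Q ∈ C i,
      TranscendentalMod (Subring.closure ((R : Set B) ∪ x '' Set.Iio a)) Q (x a)) :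
    IsGluedAlong C (Subring.closure ((R : Set B) ∪ Set.range x)) := by
  classical
  have hfin : ∀ F : Finset I, IsGluedAlong C (Subring.closure ((R : Set B) ∪ x '' F)) := by
    intro F
    induction F using Finset.induction_on_max with
    | empty => simpa [Subring.closure_eq] using hR
    | insert a F ha ih =>
      have h1 := ih.closure_union_singleton (x := x a) fun i ↦ Or.inl fun Q hQ ↦
        (hx a i Q hQ).mono (Subring.closure_mono
          (Set.union_subset_union_right _ (Set.image_mono fun b hb ↦ ha b hb)))
      intro i Q hQ Q' hQ' r hr
      refine h1 i Q hQ Q' hQ' r (Subring.closure_le.2 ?_ hr)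
      rintro y (hy | ⟨b, hb, rfl⟩)
      · exact Subring.subset_closure (Or.inl (Subring.subset_closure (Or.inl hy)))
      · obtain rfl | hb := Finset.mem_insert.1 hb
        · exact Subring.subset_closure (Or.inr rfl)
        · exact Subring.subset_closure
            (Or.inl (Subring.subset_closure (Or.inr ⟨b, hb, rfl⟩)))
  have hdir : Directed (· ≤ ·) fun F : Finset I ↦ Subring.closure ((R : Set B) ∪ x '' F) := by
    refine Monotone.directed_le fun F F' hF ↦ Subring.closure_mono
      (Set.union_subset_union_right _ (Set.image_mono ?_))
    exact_mod_cast hF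
  have hle : Subring.closure ((R : Set B) ∪ Set.range x) ≤
      ⨆ F : Finset I, Subring.closure ((R : Set B) ∪ x '' F) := by
    refine Subring.closure_le.2 ?_
    rintro y (hy | ⟨b, rfl⟩)
    · exact (Subring.mem_iSup_of_directed hdir).2 ⟨∅, Subring.subset_closure (Or.inl hy)⟩
    · exact (Subring.mem_iSup_of_directed hdir).2 ⟨{b}, Subring.subset_closure (Or.inr (by simp))⟩
  intro i Q hQ Q' hQ' r hr
  obtain ⟨F, hF⟩ := (Subring.mem_iSup_of_directed hdir).1 (hle hr)
  exact hfin F i Q hQ Q' hQ' r hF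

/-- The elements of `B` that become elements of `R` after multiplication by a regular element of
`R`. -/
def Subring.regularSaturation (R : Subring B) : Subring B where
  carrier := {b | ∃ s ∈ R, s ∈ nonZeroDivisors B ∧ s * b ∈ R}
  mul_mem' := by
    rintro a b ⟨s, hs, hs', ha⟩ ⟨t, ht, ht', hb⟩
    refine ⟨s * t, mul_mem hs ht, mul_mem hs' ht', ?_⟩
    rw [mul_mul_mul_comm]
    exact mul_mem ha hb
  one_mem' := ⟨1, R.one_mem, one_mem _, by simp⟩
  add_mem' := by
    rintro a b ⟨s, hs, hs', ha⟩ ⟨t, ht, ht', hb⟩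
    refine ⟨s * t, mul_mem hs ht, mul_mem hs' ht', ?_⟩
    have : s * t * (a + b) = t * (s * a) + s * (t * b) := by ring
    rw [this]
    exact add_mem (mul_mem ht ha) (mul_mem hs hb)
  zero_mem' := ⟨1, R.one_mem, one_mem _, by simp⟩
  neg_mem' := by
    rintro a ⟨s, hs, hs', ha⟩
    exact ⟨s, hs, hs', by rw [mul_neg]; exact neg_mem ha⟩

theorem Subring.le_regularSaturation (R : Subring B) : R ≤ R.regularSaturation :=
  fun b hb ↦ ⟨1, R.one_mem, one_mem _, by rwa [one_mul]⟩

theorem Subring.mem_regularSaturation_of_mul_mem {R : Subring B} {s b : B}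
    (hs : s ∈ R.regularSaturation) (hs' : s ∈ nonZeroDivisors B)
    (hb : s * b ∈ R.regularSaturation) : b ∈ R.regularSaturation := by
  obtain ⟨t, ht, ht', hts⟩ := hs
  obtain ⟨r, hr, hr', hrb⟩ := hb
  refine ⟨r * (t * s), mul_mem hr hts, mul_mem hr' (mul_mem ht' hs'), ?_⟩
  have : r * (t * s) * b = t * (r * (s * b)) := by ring
  rw [this]
  exact mul_mem ht hrb

theorem IsGluedAlong.regularSaturation {ι : Type*} {C : ι → Set (Ideal B)} {R : Subring B}
    (hR : IsGluedAlong C R) (hCmin : ∀ i, C i ⊆ minimalPrimes B) :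
    IsGluedAlong C R.regularSaturation := by
  rintro i Q hQ Q' hQ' b ⟨s, hs, hs', hsb⟩ hb
  have h1 := hR i Q hQ Q' hQ' _ hsb (Ideal.mul_mem_left _ _ hb)
  refine ((hCmin i hQ').1.1.mem_or_mem h1).resolve_left fun h ↦ ?_
  exact notMem_nonZeroDivisors_of_mem_mem_minimalPrimes h (hCmin i hQ') hs'

/-- A glued subring of the same size as the residue field approximating all of `B`. -/
theorem exists_isGluedAlong_approximating [IsNoetherianRing B] [IsLocalRing B]
    (hk : ℵ₀ < #(ResidueField B)) (hB : #B = #(ResidueField B)) {ι : Type*}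
    {C : ι → Set (Ideal B)} (hCmin : ∀ i, C i ⊆ minimalPrimes B) {R : Subring B}
    (hRcard : #R < #(ResidueField B)) (hR : IsGluedAlong C R) :
    ∃ R' : Subring B, R ≤ R' ∧ IsGluedAlong C R' ∧
      ∀ t ∈ nonZeroDivisors B, ∀ b : B, ∃ y, b + t * y ∈ R' := by
  obtain ⟨J, hJ⟩ : ∃ J, J = (B × nonZeroDivisors B) := ⟨_, rfl⟩
  have hJcard : #J ≤ #(ResidueField B) := by
    rw [hJ, mk_prod, lift_id, lift_id]
    exact mul_le_of_le hk.le hB.le ((mk_subtype_le _).trans hB.le)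
  obtain ⟨e⟩ : Nonempty ((#J).ord.ToType ≃ B × nonZeroDivisors B) := by
    rw [← Cardinal.eq, mk_ord_toType, hJ]
  have hIio (a : (#J).ord.ToType) (x : (#J).ord.ToType → B) :
      #(x '' Set.Iio a) < #(ResidueField B) := by
    refine (mk_image_le.trans_lt (mk_Iio_lt a ?_)).trans_le ?_
    · simp
    · simpa using hJcard
  obtain ⟨x, hx⟩ := exists_forall_of_forall_exists
    (p := fun (a : (#J).ord.ToType) A x ↦ #A < #(ResidueField B) →
      (∃ y, (e a).1 + (e a).2 * y = x) ∧ ∀ i, ∀ Q ∈ C i,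
        TranscendentalMod (Subring.closure ((R : Set B) ∪ A)) Q x) (by
    intro a A
    by_cases hA : #A < #(ResidueField B)
    · obtain ⟨y, hy⟩ := exists_forall_transcendentalMod hk
        (Subring.closure ((R : Set B) ∪ A)) (mk_closure_union_lt _ _ hk hRcard hA)
        (minimalPrimes.finite_of_isNoetherianRing B) (fun Q hQ ↦ hQ.1.1) (e a).1 (e a).2
        (fun Q hQ h ↦ notMem_nonZeroDivisors_of_mem_mem_minimalPrimes h hQ (e a).2.2)
      exact ⟨_, fun _ ↦ ⟨⟨y, rfl⟩, fun i Q hQ ↦ hy Q (hCmin i hQ)⟩⟩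
    · exact ⟨0, fun h ↦ (hA h).elim⟩)
  refine ⟨_, fun r hr ↦ Subring.subset_closure (Or.inl hr),
    hR.closure_union_range x fun a ↦ (hx a (hIio a x)).2, fun t ht b ↦ ?_⟩
  obtain ⟨a, ha⟩ := e.surjective (b, ⟨t, ht⟩)
  obtain ⟨y, hy⟩ := (hx a (hIio a x)).1
  rw [ha] at hy
  exact ⟨y, Subring.subset_closure (Or.inr ⟨a, hy.symm⟩)⟩

end Construction

section Existence

open Cardinal

variable {B : Type u} [CommRing B] [IsLocalRing B]

theorem IsGluedSubring.top {ι : Type*} {C : ι → Set (Ideal B)}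
    (hCunion : (⋃ i, C i) = minimalPrimes B) (hM : maximalIdeal B ∈ minimalPrimes B) :
    IsGluedSubring (⊤ : Subring B) B ∧ ∀ Q ∈ minimalPrimes B, ∀ Q' ∈ minimalPrimes B,
      (Q.comap (⊤ : Subring B).subtype = Q'.comap (⊤ : Subring B).subtype ↔
        ∃ i, Q ∈ C i ∧ Q' ∈ C i) := by
  have hmax : ∀ Q ∈ minimalPrimes B, Q = maximalIdeal B := fun Q hQ ↦
    have hle := le_maximalIdeal hQ.1.1.ne_top
    le_antisymm hle (hM.2 ⟨hQ.1.1, bot_le⟩ hle)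
  refine ⟨⟨Subtype.val_injective, fun t _ b ↦ ⟨⟨b, trivial⟩, 0, ?_⟩,
    fun _ _ b _ _ ↦ ⟨⟨b, trivial⟩, rfl⟩, fun Q hQ ↦ ⟨1, ?_, fun Q' hQ' ↦ Or.inr ?_⟩⟩,
    fun Q hQ Q' hQ' ↦ ?_⟩
  · rw [mul_zero, add_zero]
    rfl
  · rw [map_one]
    exact fun h1 ↦ hQ.1.1.ne_top ((Ideal.eq_top_iff_one Q).2 h1)
  · rw [hmax Q hQ, hmax Q' hQ']
  · rw [hmax Q hQ, hmax Q' hQ']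
    rw [← hCunion, Set.mem_iUnion] at hM
    obtain ⟨i, hi⟩ := hM
    exact ⟨fun _ ↦ ⟨i, hi, hi⟩, fun _ ↦ rfl⟩

/-- The subring gluing the minimal primes of `B` according to a given partition. -/
theorem exists_isGluedSubring [IsNoetherianRing B] [IsReduced B] [Algebra ℚ B]
    (hk : ℵ₀ < #(ResidueField B))
    (hB : #B = #(ResidueField B)) {ι : Type*} [Finite ι] {C : ι → Set (Ideal B)}
    (hCdisj : ∀ i j, i ≠ j → Disjoint (C i) (C j)) (hCunion : (⋃ i, C i) = minimalPrimes B) :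
    ∃ S : Subring B, IsGluedSubring S B ∧ (algebraMap ℚ B).range ≤ S ∧
      ((∃ t ∈ maximalIdeal B, t ∈ nonZeroDivisors B) ∨ Function.Surjective (algebraMap S B)) ∧
      ∀ Q ∈ minimalPrimes B, ∀ Q' ∈ minimalPrimes B,
        (Q.comap S.subtype = Q'.comap S.subtype ↔ ∃ i, Q ∈ C i ∧ Q' ∈ C i) := by
  classical
  by_cases hM : maximalIdeal B ∈ minimalPrimes B
  · obtain ⟨h1, h2⟩ := IsGluedSubring.top hCunion hM
    exact ⟨⊤, h1, le_top, Or.inr fun b ↦ ⟨⟨b, trivial⟩, rfl⟩, h2⟩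
  have hCmin (i : ι) : C i ⊆ minimalPrimes B := hCunion ▸ Set.subset_iUnion C i
  have hex (Q : Ideal B) (hQ : Q ∈ minimalPrimes B) : ∃ i, Q ∈ C i := by
    rwa [← hCunion, Set.mem_iUnion] at hQ
  obtain ⟨R₀, hcard₀, hglue₀, hrat, hsep⟩ := exists_isGluedAlong_separating hk hCdisj hCmin
  obtain ⟨R, hle, hglue, happrox⟩ := exists_isGluedAlong_approximating hk hB hCmin hcard₀ hglue₀
  have hle' : R₀ ≤ R.regularSaturation := hle.trans R.le_regularSaturation
  have hglue' := hglue.regularSaturation hCmin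
  choose u hu hu' using hsep
  have hsame (i : ι) (Q : Ideal B) (hQ : Q ∈ C i) (Q' : Ideal B) (hQ' : Q' ∈ C i) :
      Q.comap R.regularSaturation.subtype = Q'.comap R.regularSaturation.subtype :=
    Ideal.ext fun x ↦ ⟨hglue' i Q hQ Q' hQ' x x.2, hglue' i Q' hQ' Q hQ x x.2⟩
  have := Fintype.ofFinite ι
  refine ⟨R.regularSaturation, ⟨Subtype.val_injective, fun t ht b ↦ ?_, fun s hs b s' hb ↦ ?_,
    fun Q hQ ↦ ?_⟩, hrat.trans hle',
    Or.inl (exists_mem_nonZeroDivisors_of_notMem_minimalPrimes _ hM), fun Q hQ Q' hQ' ↦ ?_⟩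
  · obtain ⟨y, hy⟩ := happrox t ht b
    exact ⟨⟨_, R.le_regularSaturation hy⟩, -y, by
      change b = b + t * y + t * -y
      ring⟩
  · refine ⟨⟨b, Subring.mem_regularSaturation_of_mul_mem s.2 hs ?_⟩, rfl⟩
    have : (s : B) * b = s' := hb
    rw [this]
    exact s'.2
  · obtain ⟨i, hi⟩ := hex Q hQ
    refine ⟨∏ j ∈ Finset.univ.erase i, ⟨u j, hle' (hu j)⟩, ?_, fun Q' hQ' ↦ ?_⟩
    · have := hQ.1.1
      rw [map_prod, Ideal.IsPrime.prod_mem_iff]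
      rintro ⟨j, hj, hmem⟩
      exact Finset.ne_of_mem_erase hj ((hu' j i Q hi).1 hmem).symm
    · obtain ⟨k, hk⟩ := hex Q' hQ'
      by_cases hki : k = i
      · subst hki
        exact Or.inr (hsame k Q' hk Q hi)
      · left
        have := hQ'.1.1
        rw [map_prod, Ideal.IsPrime.prod_mem_iff]
        exact ⟨k, Finset.mem_erase.2 ⟨hki, Finset.mem_univ _⟩, (hu' k k Q' hk).2 rfl⟩
  · refine ⟨fun h ↦ ?_, fun ⟨i, hi, hi'⟩ ↦ hsame i Q hi Q' hi'⟩
    obtain ⟨i, hi⟩ := hex Q hQ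
    obtain ⟨j, hj⟩ := hex Q' hQ'
    have h1 : (⟨u i, hle' (hu i)⟩ : R.regularSaturation) ∈
        Q'.comap R.regularSaturation.subtype := by
      rw [← h]
      exact (hu' i i Q hi).2 rfl
    obtain rfl := (hu' i j Q' hj).1 h1
    exact ⟨j, hi, hj⟩

end Existence

theorem statement1
    (B : Type u) [CommRing B] [IsNoetherianRing B] [IsLocalRing B] [IsReduced B]
    [Algebra ℚ B] [Uncountable (ResidueField B)]
    (hqe : IsQuasiExcellentRing B)
    (hcard : Cardinal.mk B = Cardinal.mk (ResidueField B))
    (m : ℕ) (hm : 1 ≤ m) (C : Fin m → Set (Ideal B))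
    (hCne : ∀ i, (C i).Nonempty)
    (hCdisj : ∀ i j, i ≠ j → Disjoint (C i) (C j))
    (hCunion : (⋃ i, C i) = minimalPrimes B) :
    ∃ S : Subring B, ∃ hS : IsLocalRing ↥S,
      letI := hS
      IsNoetherianRing ↥S ∧ IsReduced ↥S ∧
      -- `S` is a QUASI-EXCELLENT local subring with maximal ideal `S ∩ M`
      IsQuasiExcellentRing ↥S ∧
      maximalIdeal ↥S = (maximalIdeal B).comap S.subtype ∧
      -- (1) `S` contains the rationals
      Set.range (algebraMap ℚ B) ⊆ (S : Set B) ∧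
      -- (2) the completion of `S` (at `S ∩ M`) is the completion of `B` (at `M`),
      -- via an isomorphism compatible with the inclusion `S ⊆ B`
      (∃ e : AdicCompletion (maximalIdeal ↥S) ↥S ≃+* AdicCompletion (maximalIdeal B) B,
        ∀ s : ↥S, e (algebraMap ↥S (AdicCompletion (maximalIdeal ↥S) ↥S) s) =
          algebraMap B (AdicCompletion (maximalIdeal B) B) (s : B)) ∧
      -- (3) `S/(S ∩ M)` is uncountable and `|S| = |S/(S ∩ M)|`
      Uncountable (ResidueField ↥S) ∧
      Cardinal.mk ↥S = Cardinal.mk (ResidueField ↥S) ∧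
      -- (4) minimal primes are glued exactly according to the partition
      (∀ Q ∈ minimalPrimes B, ∀ Q' ∈ minimalPrimes B,
        (Q.comap S.subtype = Q'.comap S.subtype ↔ ∃ i, Q ∈ C i ∧ Q' ∈ C i)) ∧
      -- (5) the contraction map `Spec B → Spec S` is onto, and `f(P)B = P` for primes
      -- `P` of positive height
      (∀ q : Ideal ↥S, q.IsPrime → ∃ P : Ideal B, P.IsPrime ∧ P.comap S.subtype = q) ∧
      (∀ (P : Ideal B) (hP : P.IsPrime),
        0 < Order.height (⟨P, hP⟩ : PrimeSpectrum B) →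
        (P.comap S.subtype).map S.subtype = P) := by
  obtain ⟨S, h, hrat, hM, hglue⟩ := exists_isGluedSubring
    (Cardinal.aleph0_lt_mk_iff.2 ‹_›) hcard hCdisj hCunion
  have hS := h.isLocalRing
  have hloc := h.isLocalHom
  letI : Algebra ℚ S :=
    ((algebraMap ℚ B).codRestrict S fun x ↦ hrat ⟨x, rfl⟩).toAlgebra
  have hres : Function.Bijective (ResidueField.map (algebraMap S B)) := by
    refine ⟨RingHom.injective _, fun y ↦ ?_⟩
    obtain ⟨b, rfl⟩ := residue_surjective y
    obtain ⟨s, hs⟩ := h.exists_sub_mem_maximalIdeal_pow hM 1 b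
    refine ⟨residue S s, ?_⟩
    rw [pow_one, ← residue_eq_zero_iff, map_sub, sub_eq_zero] at hs
    exact hs
  have hunc : Uncountable (ResidueField S) := hres.2.uncountable
  have hmk : Cardinal.mk (ResidueField S) = Cardinal.mk (ResidueField B) :=
    Cardinal.mk_congr (Equiv.ofBijective _ hres)
  refine ⟨S, hS, h.isNoetherianRing, h.isReduced, h.isQuasiExcellentRing hM hqe,
    (maximalIdeal_comap (algebraMap S B)).symm, fun x hx ↦ hrat hx, ?_, hunc, ?_, hglue,
    fun q hq ↦ h.exists_comap_eq q, fun P hP hpos ↦ ?_⟩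
  · obtain ⟨e⟩ := h.nonempty_algEquiv_adicCompletion hM
    exact ⟨e.toRingEquiv, fun s ↦ e.commutes s⟩
  · refine le_antisymm ?_ (Cardinal.mk_le_of_surjective residue_surjective)
    rw [hmk, ← hcard]
    exact Cardinal.mk_subtype_le _
  · have hmin : P ∉ minimalPrimes B := by
      intro hP'
      refine hpos.ne' (Order.height_eq_zero.2 fun P' hle ↦ ?_)
      exact hP'.2 ⟨P'.2, bot_le⟩ hle
    obtain ⟨t, htP, ht⟩ := exists_mem_nonZeroDivisors_of_notMem_minimalPrimes P hmin
    exact h.map_comap htP ht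
end

section
/- Assume setting (†). Let (T, M) be a local ring containing the rationals and let Q₁, Q₂ ∈ Spec(T) with Q₁ ⊄ Q₂ and Q₂ ⊄ Q₁. Let T̄ = T/(Q₁ ∩ Q₂), with Q̄ᵢ = Qᵢ/(Q₁ ∩ Q₂) and Q̄ᵢᵉ = Q̄ᵢ·T̄[[y₁, …, yₙ]] for i = 1, 2. Then the set of minimal prime ideals over I·T̄[[y₁, …, yₙ]] in T̄[[y₁, …, yₙ]] is exactly { (Q̄ᵢᵉ, 𝔮ⱼ·T̄[[y₁, …, yₙ]]) : i ∈ {1, 2}, j ∈ {1, …, k} }, and these 2k prime ideals are pairwise distinct. -/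
/-!
Setting (†): `y₁, …, yₙ` are indeterminates, `I` is a proper ideal of `ℚ[[y₁, …, yₙ]]`
with minimal primes `𝔮₁, …, 𝔮ₖ`, and for every integral domain `D` containing `ℚ` the
extensions `𝔮ᵢ·D[[y₁, …, yₙ]]` are prime and pairwise incomparable.

We model `A[[y₁, …, yₙ]]` as `MvPowerSeries (Fin n) A`.  A "local ring" is a
commutative Noetherian ring with exactly one maximal ideal.
-/

universe u

/-- The extension of an ideal `J` of `ℚ[[y₁, …, yₙ]]` to `A[[y₁, …, yₙ]]`, for a
`ℚ`-algebra `A`. -/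
noncomputable def Ideal.psExt (n : ℕ) (A : Type u) [CommRing A] [Algebra ℚ A]
    (J : Ideal (MvPowerSeries (Fin n) ℚ)) : Ideal (MvPowerSeries (Fin n) A) :=
  J.map (MvPowerSeries.map (σ := Fin n) (algebraMap ℚ A))

/-- The extension of an ideal `a` of `A` to the power series ring `A[[y₁, …, yₙ]]`. -/
noncomputable def Ideal.constExt (n : ℕ) {A : Type u} [CommRing A] (a : Ideal A) :
    Ideal (MvPowerSeries (Fin n) A) :=
  a.map (MvPowerSeries.C (σ := Fin n) (R := A))

open MvPowerSeries in
/-- For `a` finitely generated, `a·A[[y₁, …, yₙ]]` contains every power series with all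
coefficients in `a`. -/
theorem Ideal.mem_constExt_of_coeff_mem {n : ℕ} {A : Type u} [CommRing A] {a : Ideal A}
    (ha : a.FG) {f : MvPowerSeries (Fin n) A} (hf : ∀ d, coeff d f ∈ a) :
    f ∈ a.constExt n := by
  obtain ⟨m, g, rfl⟩ := Submodule.fg_iff_exists_fin_generating_family.mp ha
  choose c hc using fun d ↦ Ideal.mem_span_range_iff_exists_fun.mp (hf d)
  let h (i : Fin m) : MvPowerSeries (Fin n) A := fun d ↦ c d i
  have hsum : f = ∑ i, h i * C (g i) := by
    ext d
    rw [← hc d, map_sum]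
    exact Finset.sum_congr rfl fun i _ ↦ (coeff_mul_C d (h i) (g i)).symm
  rw [hsum]
  exact Ideal.sum_mem _ fun i _ ↦ Ideal.mul_mem_left _ _
    (Ideal.mem_map_of_mem _ (Ideal.subset_span ⟨i, rfl⟩))

open MvPowerSeries in
theorem MvPowerSeries.ker_map_quotient_mk {n : ℕ} {A : Type u} [CommRing A] {a : Ideal A}
    (ha : a.FG) :
    RingHom.ker (map (σ := Fin n) (Ideal.Quotient.mk a)) = a.constExt n := by
  refine le_antisymm (fun f hf ↦ Ideal.mem_constExt_of_coeff_mem ha fun d ↦ ?_) ?_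
  · rw [← Ideal.Quotient.eq_zero_iff_mem, ← coeff_map, RingHom.mem_ker.mp hf, map_zero]
  · refine Ideal.map_le_iff_le_comap.mpr fun x hx ↦ ?_
    rw [Ideal.mem_comap, RingHom.mem_ker, map_C, Ideal.Quotient.eq_zero_iff_mem.mpr hx, map_zero]

theorem MvPowerSeries.map_surjective {σ R S : Type*} [CommRing R] [CommRing S] {f : R →+* S}
    (hf : Function.Surjective f) : Function.Surjective (map (σ := σ) f) := by
  intro g
  choose c hc using fun d ↦ hf (coeff d g)
  exact ⟨fun d ↦ c d, MvPowerSeries.ext hc⟩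

theorem Ideal.psExt_map {n : ℕ} {A B : Type u} [CommRing A] [CommRing B] [Algebra ℚ A]
    [Algebra ℚ B] (f : A →+* B) (J : Ideal (MvPowerSeries (Fin n) ℚ)) :
    (J.psExt n A).map (MvPowerSeries.map f) = J.psExt n B := by
  rw [Ideal.psExt, Ideal.psExt, Ideal.map_map, ← MvPowerSeries.map_comp,
    Subsingleton.elim (f.comp (algebraMap ℚ A)) (algebraMap ℚ B)]

theorem Ideal.comap_psExt_quotient {n : ℕ} {A : Type u} [CommRing A] [Algebra ℚ A]
    {a : Ideal A} (ha : a.FG) (J : Ideal (MvPowerSeries (Fin n) ℚ)) :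
    (J.psExt n (A ⧸ a)).comap (MvPowerSeries.map (Ideal.Quotient.mk a)) =
      a.constExt n ⊔ J.psExt n A := by
  rw [← Ideal.psExt_map (Ideal.Quotient.mk a), Ideal.comap_map_of_surjective'
    _ (MvPowerSeries.map_surjective Ideal.Quotient.mk_surjective),
    MvPowerSeries.ker_map_quotient_mk ha, sup_comm]

open MvPowerSeries in
/-- A proper ideal of `ℚ[[y₁, …, yₙ]]` contributes nothing to the constant terms. -/
theorem Ideal.constExt_sup_psExt_le_comap_constantCoeff {n : ℕ} {A : Type u} [CommRing A]
    [Algebra ℚ A] (a : Ideal A) {J : Ideal (MvPowerSeries (Fin n) ℚ)} (hJ : J ≠ ⊤) :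
    a.constExt n ⊔ J.psExt n A ≤ a.comap (constantCoeff (σ := Fin n)) := by
  refine sup_le (Ideal.map_le_iff_le_comap.mpr fun x hx ↦ ?_)
    (Ideal.map_le_iff_le_comap.mpr fun f hf ↦ ?_)
  · simpa using hx
  · have hf0 : constantCoeff f = 0 := by
      by_contra h
      exact hJ (Ideal.eq_top_of_isUnit_mem J hf (isUnit_iff_constantCoeff.mpr (Ne.isUnit h)))
    simp [Ideal.mem_comap, constantCoeff_map, hf0]

open MvPowerSeries in
theorem Ideal.le_of_constExt_sup_psExt_le {n : ℕ} {A : Type u} [CommRing A] [Algebra ℚ A]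
    {a b : Ideal A} {J K : Ideal (MvPowerSeries (Fin n) ℚ)} (hK : K ≠ ⊤)
    (h : a.constExt n ⊔ J.psExt n A ≤ b.constExt n ⊔ K.psExt n A) : a ≤ b := by
  intro x hx
  have := Ideal.constExt_sup_psExt_le_comap_constantCoeff b hK
    (h (Ideal.mem_sup_left (Ideal.mem_map_of_mem C hx)))
  simpa using this

theorem Ideal.psExt_le_of_constExt_sup_psExt_le {n : ℕ} {A : Type u} [CommRing A] [Algebra ℚ A]
    {a : Ideal A} (ha : a.FG) {J K : Ideal (MvPowerSeries (Fin n) ℚ)}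
    (h : a.constExt n ⊔ J.psExt n A ≤ a.constExt n ⊔ K.psExt n A) :
    J.psExt n (A ⧸ a) ≤ K.psExt n (A ⧸ a) := by
  rw [← Ideal.psExt_map (Ideal.Quotient.mk a) J, Ideal.map_le_iff_le_comap,
    Ideal.comap_psExt_quotient ha]
  exact le_sup_right.trans h

/-- Over a Noetherian `ℚ`-algebra with finitely many pairwise incomparable primes `a i` of
product zero, the ideals `(a i, 𝔮ⱼ)` are the minimal primes over the extension of `I`, and they
are pairwise distinct. -/
theorem Ideal.minimalPrimes_psExt {n : ℕ} {ι κ : Type*} [Fintype ι] {A : Type u} [CommRing A]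
    [IsNoetherianRing A] [Algebra ℚ A] {I : Ideal (MvPowerSeries (Fin n) ℚ)}
    {q : κ → Ideal (MvPowerSeries (Fin n) ℚ)} (hqmin : I.minimalPrimes = Set.range q)
    (hqprime : ∀ (D : Type u) [CommRing D] [IsDomain D] [Algebra ℚ D] (j : κ),
      ((q j).psExt n D).IsPrime)
    (hqincomp : ∀ (D : Type u) [CommRing D] [IsDomain D] [Algebra ℚ D] (i j : κ),
      (q i).psExt n D ≤ (q j).psExt n D ↔ i = j)
    (a : ι → Ideal A) (haprime : ∀ i, (a i).IsPrime) (haincomp : ∀ i i', a i ≤ a i' → i = i')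
    (haprod : ∏ i, a i = ⊥) :
    (I.psExt n A).minimalPrimes = {P | ∃ i j, P = (a i).constExt n ⊔ (q j).psExt n A} ∧
      ∀ i i' j j', (a i).constExt n ⊔ (q j).psExt n A = (a i').constExt n ⊔ (q j').psExt n A →
        i = i' ∧ j = j' := by
  have hfg (i : ι) : (a i).FG := (isNoetherianRing_iff_ideal_fg A).mp inferInstance _
  have hq (j : κ) : q j ∈ I.minimalPrimes := hqmin ▸ Set.mem_range_self j
  have hle (i i' : ι) (j j' : κ)
      (h : (a i).constExt n ⊔ (q j).psExt n A ≤ (a i').constExt n ⊔ (q j').psExt n A) :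
      i = i' ∧ j = j' := by
    obtain rfl := haincomp _ _ (Ideal.le_of_constExt_sup_psExt_le (hq j').1.1.ne_top h)
    exact ⟨rfl, (hqincomp (A ⧸ a i) j j').mp (Ideal.psExt_le_of_constExt_sup_psExt_le (hfg i) h)⟩
  have hprime (i : ι) (j : κ) : ((a i).constExt n ⊔ (q j).psExt n A).IsPrime := by
    have := hqprime (A ⧸ a i) j
    rw [← Ideal.comap_psExt_quotient (hfg i)]
    infer_instance
  have hover (i : ι) (j : κ) : I.psExt n A ≤ (a i).constExt n ⊔ (q j).psExt n A :=
    (Ideal.map_mono (hq j).1.2).trans le_sup_right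
  have hbelow (P : Ideal (MvPowerSeries (Fin n) A)) [P.IsPrime] (hP : I.psExt n A ≤ P) :
      ∃ i j, (a i).constExt n ⊔ (q j).psExt n A ≤ P := by
    have hprod : ∏ i, a i ≤ P.comap MvPowerSeries.C := haprod ▸ bot_le
    obtain ⟨i, -, hi⟩ := (Ideal.IsPrime.prod_le inferInstance).mp hprod
    obtain ⟨p, hp, hpP⟩ := Ideal.exists_minimalPrimes_le (Ideal.map_le_iff_le_comap.mp hP)
    obtain ⟨j, rfl⟩ := hqmin ▸ hp
    exact ⟨i, j, sup_le (Ideal.map_le_iff_le_comap.mpr hi) (Ideal.map_le_iff_le_comap.mpr hpP)⟩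
  refine ⟨Set.ext fun P ↦ ⟨fun hP ↦ ?_, ?_⟩, fun i i' j j' h ↦ hle i i' j j' h.le⟩
  · have := hP.1.1
    obtain ⟨i, j, hij⟩ := hbelow P hP.1.2
    exact ⟨i, j, le_antisymm (hP.2 ⟨hprime i j, hover i j⟩ hij) hij⟩
  · rintro ⟨i, j, rfl⟩
    refine ⟨⟨hprime i j, hover i j⟩, fun P hP hPle ↦ ?_⟩
    have := hP.1
    obtain ⟨i', j', hP'⟩ := hbelow P hP.2
    obtain ⟨rfl, rfl⟩ := hle _ _ _ _ (hP'.trans hPle)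
    exact hP'

theorem statement3
    -- Setting (†)
    (n k : ℕ) (I : Ideal (MvPowerSeries (Fin n) ℚ)) (hI : I ≠ ⊤)
    (q : Fin k → Ideal (MvPowerSeries (Fin n) ℚ)) (hqinj : Function.Injective q)
    (hqmin : I.minimalPrimes = Set.range q)
    (hqprime : ∀ (D : Type u) [CommRing D] [IsDomain D] [Algebra ℚ D] (i : Fin k),
      ((q i).psExt n D).IsPrime)
    (hqincomp : ∀ (D : Type u) [CommRing D] [IsDomain D] [Algebra ℚ D] (i j : Fin k),
      (q i).psExt n D ≤ (q j).psExt n D ↔ i = j)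
    -- the local ring `T` and the primes `Q₁`, `Q₂`
    (T : Type u) [CommRing T] [IsNoetherianRing T] [IsLocalRing T] [Algebra ℚ T]
    (Q₁ Q₂ : Ideal T) [Q₁.IsPrime] [Q₂.IsPrime]
    (h12 : ¬Q₁ ≤ Q₂) (h21 : ¬Q₂ ≤ Q₁) :
    -- with `T̄ = T/(Q₁ ∩ Q₂)` and `Q̄ᵢᵉ = (Qᵢ/(Q₁ ∩ Q₂))·T̄[[y₁, …, yₙ]]`, the minimal
    -- primes over `I·T̄[[y₁, …, yₙ]]` are exactly the `(Q̄ᵢᵉ, 𝔮ⱼ·T̄[[y₁, …, yₙ]])`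
    (I.psExt n (T ⧸ (Q₁ ⊓ Q₂))).minimalPrimes =
      { P | ∃ (i : Fin 2) (j : Fin k),
          P = ((![Q₁, Q₂] i).map (Ideal.Quotient.mk (Q₁ ⊓ Q₂))).constExt n ⊔
            (q j).psExt n (T ⧸ (Q₁ ⊓ Q₂)) } ∧
    -- and these `2k` prime ideals are pairwise distinct
    (∀ (i i' : Fin 2) (j j' : Fin k),
      ((![Q₁, Q₂] i).map (Ideal.Quotient.mk (Q₁ ⊓ Q₂))).constExt n ⊔
          (q j).psExt n (T ⧸ (Q₁ ⊓ Q₂)) =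
        ((![Q₁, Q₂] i').map (Ideal.Quotient.mk (Q₁ ⊓ Q₂))).constExt n ⊔
          (q j').psExt n (T ⧸ (Q₁ ⊓ Q₂)) →
      i = i' ∧ j = j') := by
  have hmk : Function.Surjective (Ideal.Quotient.mk (Q₁ ⊓ Q₂)) := Ideal.Quotient.mk_surjective
  have hker (i : Fin 2) : RingHom.ker (Ideal.Quotient.mk (Q₁ ⊓ Q₂)) ≤ ![Q₁, Q₂] i := by
    rw [Ideal.mk_ker]
    fin_cases i
    exacts [inf_le_left, inf_le_right]
  have hQ (i : Fin 2) : (![Q₁, Q₂] i).IsPrime := by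
    fin_cases i <;> assumption
  refine Ideal.minimalPrimes_psExt hqmin hqprime hqincomp
    (fun i ↦ (![Q₁, Q₂] i).map (Ideal.Quotient.mk (Q₁ ⊓ Q₂)))
    (fun i ↦ Ideal.map_isPrime_of_surjective hmk (hker i)) (fun i i' h ↦ ?_) ?_
  · rw [Ideal.map_le_iff_le_comap, Ideal.comap_map_of_surjective' _ hmk,
      sup_eq_left.mpr (hker i')] at h
    fin_cases i <;> fin_cases i'
    exacts [rfl, absurd h h12, absurd h h21, rfl]
  · rw [Fin.prod_univ_two, ← Ideal.map_mul, Ideal.map_eq_bot_iff_le_ker, Ideal.mk_ker]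
    exact Ideal.mul_le_inf
end

section
/- Assume setting (†). Let (T, M) be a local ring containing the rationals, let Q₁, Q₂ ∈ Spec(T) with Q₁ ⊄ Q₂ and Q₂ ⊄ Q₁, let T̄ = T/(Q₁ ∩ Q₂) with maximal ideal M̄, and let (R, R ∩ M̄) be a local subring of T̄ such that R contains the rationals, R is an integral domain, and the completion of R is isomorphic to the completion of T̄. Then the set of minimal prime ideals over I·R[[y₁, …, yₙ]] in R[[y₁, …, yₙ]] is exactly { 𝔮ⱼ·R[[y₁, …, yₙ]] : j ∈ {1, …, k} }. -/
/-!
Setting (†): `y₁, …, yₙ` are indeterminates, `I` is a proper ideal of `ℚ[[y₁, …, yₙ]]`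
with minimal primes `𝔮₁, …, 𝔮ₖ`, and for every integral domain `D` containing `ℚ` the
extensions `𝔮ᵢ·D[[y₁, …, yₙ]]` are prime and pairwise incomparable.

We model `A[[y₁, …, yₙ]]` as `MvPowerSeries (Fin n) A`.  A "local ring" is a
commutative Noetherian ring with exactly one maximal ideal.
-/

universe u

open IsLocalRing

/-- Let `q` enumerate the minimal primes of `I`. If their extensions along `f` are prime and
pairwise incomparable, then these extensions are the minimal primes of the extension of `I`. -/
theorem Ideal.minimalPrimes_map_eq_range {A B ι : Type*} [CommRing A] [CommRing B] (f : A →+* B)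
    {I : Ideal A} {q : ι → Ideal A} (hqmin : I.minimalPrimes = Set.range q)
    (hprime : ∀ i, ((q i).map f).IsPrime)
    (hincomp : ∀ i j, (q i).map f ≤ (q j).map f → i = j) :
    (I.map f).minimalPrimes = Set.range fun j => (q j).map f := by
  have le_map (j : ι) : I.map f ≤ (q j).map f :=
    Ideal.map_mono (hqmin.symm ▸ Set.mem_range_self j : q j ∈ I.minimalPrimes).1.2
  have exists_map_le (P : Ideal B) (hP : P.IsPrime) (hIP : I.map f ≤ P) :
      ∃ j, (q j).map f ≤ P := by
    obtain ⟨p, hp, hpP⟩ := Ideal.exists_minimalPrimes_le (Ideal.map_le_iff_le_comap.1 hIP)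
    obtain ⟨j, rfl⟩ := hqmin ▸ hp
    exact ⟨j, Ideal.map_le_iff_le_comap.2 hpP⟩
  ext P
  constructor
  · intro hP
    obtain ⟨j, hj⟩ := exists_map_le P hP.1.1 hP.1.2
    exact ⟨j, le_antisymm hj (hP.2 ⟨hprime j, le_map j⟩ hj)⟩
  · rintro ⟨j, rfl⟩
    refine ⟨⟨hprime j, le_map j⟩, fun P hP hPj => ?_⟩
    obtain ⟨i, hi⟩ := exists_map_le P hP.1 hP.2
    obtain rfl := hincomp i j (hi.trans hPj)
    exact hi

theorem statement4
    -- Setting (†)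
    (n k : ℕ) (I : Ideal (MvPowerSeries (Fin n) ℚ)) (hI : I ≠ ⊤)
    (q : Fin k → Ideal (MvPowerSeries (Fin n) ℚ)) (hqinj : Function.Injective q)
    (hqmin : I.minimalPrimes = Set.range q)
    (hqprime : ∀ (D : Type u) [CommRing D] [IsDomain D] [Algebra ℚ D] (i : Fin k),
      ((q i).psExt n D).IsPrime)
    (hqincomp : ∀ (D : Type u) [CommRing D] [IsDomain D] [Algebra ℚ D] (i j : Fin k),
      (q i).psExt n D ≤ (q j).psExt n D ↔ i = j)
    -- the local ring `T` and the primes `Q₁`, `Q₂`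
    (T : Type u) [CommRing T] [IsNoetherianRing T] [IsLocalRing T] [Algebra ℚ T]
    (Q₁ Q₂ : Ideal T) [Q₁.IsPrime] [Q₂.IsPrime]
    (h12 : ¬Q₁ ≤ Q₂) (h21 : ¬Q₂ ≤ Q₁)
    -- `(R, R ∩ M̄)`: a local subring of `T̄ = T/(Q₁ ∩ Q₂)` which is a domain, contains
    -- the rationals, and whose completion is isomorphic to that of `T̄`
    (R : Subring (T ⧸ (Q₁ ⊓ Q₂))) (hRloc : IsLocalRing ↥R) [IsNoetherianRing ↥R]
    [Algebra ℚ ↥R] (hRdom : IsDomain ↥R)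
    (hRmax : letI := hRloc; maximalIdeal ↥R =
      ((maximalIdeal T).map (Ideal.Quotient.mk (Q₁ ⊓ Q₂))).comap R.subtype)
    (hRcomp : Nonempty
      (AdicCompletion (((maximalIdeal T).map (Ideal.Quotient.mk (Q₁ ⊓ Q₂))).comap
          R.subtype) ↥R ≃+*
        AdicCompletion ((maximalIdeal T).map (Ideal.Quotient.mk (Q₁ ⊓ Q₂)))
          (T ⧸ (Q₁ ⊓ Q₂)))) :
    -- the minimal primes over `I·R[[y₁, …, yₙ]]` are exactly the `𝔮ⱼ·R[[y₁, …, yₙ]]`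
    (I.psExt n ↥R).minimalPrimes = Set.range fun j : Fin k => (q j).psExt n ↥R := by
  exact Ideal.minimalPrimes_map_eq_range _ hqmin (fun j => hqprime R j)
    fun i j => (hqincomp R i j).1
end

section
/- Let (R, m) be a local (Noetherian) ring containing the rationals, let y₁, …, yₙ be indeterminates, and let I be an ideal of ℚ[[y₁, …, yₙ]]. Then the completion of the local ring R[[y₁, …, yₙ]]/I·R[[y₁, …, yₙ]] with respect to its maximal ideal is isomorphic to R̂[[y₁, …, yₙ]]/I·R̂[[y₁, …, yₙ]], where R̂ is the completion of R with respect to m. -/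
/-!
If `(R, m)` is a local ring containing the rationals and `I` is an ideal of
`ℚ[[y₁, …, yₙ]]`, then the completion of the local ring `R[[y₁, …, yₙ]]/I·R[[y₁, …, yₙ]]`
is isomorphic to `R̂[[y₁, …, yₙ]]/I·R̂[[y₁, …, yₙ]]`.

Conventions: a "local ring" is a commutative Noetherian ring with exactly one maximal
ideal; completions are maximal-ideal-adic completions (`AdicCompletion`);
`A[[y₁, …, yₙ]]` is modeled as `MvPowerSeries (Fin n) A`; `I·A[[y₁, …, yₙ]]` is the
extension of `I` along the coefficient map `ℚ → A`.  The hypothesis that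
`R[[y₁, …, yₙ]]/I·R[[y₁, …, yₙ]]` is local (as in "the local ring …") is recorded as an
instance.
-/

universe u

open IsLocalRing

namespace MvPowerSeries

variable {σ R : Type*} [CommRing R] (m : Ideal R)

/-- The ideal of `R[[y]]` generated by an ideal `m` of `R` and the variables. -/
noncomputable def idealSupVars (σ : Type*) : Ideal (MvPowerSeries σ R) :=
  m.map (C (σ := σ)) ⊔ Ideal.span (Set.range X)

theorem coeff_mem_of_mem_idealSupVars_pow (k : ℕ) {f : MvPowerSeries σ R}
    (hf : f ∈ idealSupVars m σ ^ k) (d : σ →₀ ℕ) : coeff d f ∈ m ^ (k - d.degree) := by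
  classical
  let F (k : ℕ) : Ideal (MvPowerSeries σ R) :=
    { carrier := {f | ∀ d, coeff d f ∈ m ^ (k - d.degree)}
      add_mem' := fun ha hb d ↦ by
        rw [map_add]; exact add_mem (ha d) (hb d)
      zero_mem' := fun d ↦ by simp
      smul_mem' := fun c f hf d ↦ by
        rw [smul_eq_mul, coeff_mul]
        refine sum_mem fun p hp ↦ Ideal.mul_mem_left _ _ ?_
        refine Ideal.pow_le_pow_right ?_ (hf p.2)
        have := Finset.HasAntidiagonal.mem_antidiagonal.1 hp
        have : d.degree = p.1.degree + p.2.degree := by rw [← this, map_add]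
        lia }
  have hmul (j k : ℕ) : F j * F k ≤ F (j + k) := by
    refine Ideal.mul_le.2 fun a ha b hb d ↦ ?_
    rw [coeff_mul]
    refine sum_mem fun p hp ↦ ?_
    have := Ideal.mul_mem_mul (ha p.1) (hb p.2)
    rw [← pow_add] at this
    refine Ideal.pow_le_pow_right ?_ this
    have := Finset.HasAntidiagonal.mem_antidiagonal.1 hp
    have : d.degree = p.1.degree + p.2.degree := by rw [← this, map_add]
    lia
  have h1 : idealSupVars m σ ≤ F 1 := by
    refine sup_le (Ideal.map_le_iff_le_comap.2 fun a ha d ↦ ?_) (Ideal.span_le.2 ?_)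
    · rw [coeff_C]
      split_ifs with h
      · simpa [h] using ha
      · simp
    · rintro _ ⟨i, rfl⟩ d
      rw [coeff_X]
      split_ifs with h
      · simp [h]
      · simp
  have hF (k : ℕ) : idealSupVars m σ ^ k ≤ F k := by
    induction k with
    | zero => exact fun f _ d ↦ by simp
    | succ k ih =>
      rw [pow_succ]
      exact (Ideal.mul_mono ih h1).trans (hmul k 1)
  exact hF k hf d

theorem exists_eq_C_add_sum_X_mul [Fintype σ] (f : MvPowerSeries σ R) :
    ∃ g : σ → MvPowerSeries σ R, f = C (constantCoeff f) + ∑ i, X i * g i ∧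
      ∀ i d, coeff d (g i) = coeff (d + Finsupp.single i 1) f ∨ coeff d (g i) = 0 := by
  classical
  have hc (d : σ →₀ ℕ) : ∃ i : Option σ, (d = 0 ↔ i = none) ∧ ∀ j, i = some j → d j ≠ 0 := by
    by_cases hd : d = 0
    · exact ⟨none, by simp [hd]⟩
    · obtain ⟨j, hj⟩ := Finsupp.ne_iff.1 hd
      exact ⟨some j, by simp [hd], by simpa using hj⟩
  choose c hc0 hc1 using hc
  choose g hg using fun i ↦ (⟨fun d ↦ if c (d + Finsupp.single i 1) = some i then
    coeff (d + Finsupp.single i 1) f else 0, fun _ ↦ rfl⟩ : ∃ p : MvPowerSeries σ R, ∀ d,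
      coeff d p = if c (d + Finsupp.single i 1) = some i then
        coeff (d + Finsupp.single i 1) f else 0)
  refine ⟨g, ?_, fun i d ↦ ?_⟩
  · ext d
    rw [map_add, map_sum, coeff_C]
    have hX (i : σ) (g : MvPowerSeries σ R) : coeff d (X i * g) =
        if d i = 0 then 0 else coeff (d - Finsupp.single i 1) g := by
      rw [X_def, coeff_monomial_mul, one_mul]
      simp [Finsupp.single_le_iff, Nat.one_le_iff_ne_zero]
    have hle {i : σ} (hi : d i ≠ 0) : Finsupp.single i 1 ≤ d := by
      rw [Finsupp.single_le_iff]; exact Nat.one_le_iff_ne_zero.2 hi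
    by_cases hd : d = 0
    · subst hd
      simp
    · obtain ⟨j, hj⟩ := Option.ne_none_iff_exists'.1 (mt (hc0 d).2 hd)
      rw [if_neg hd, zero_add, Finset.sum_eq_single j]
      · rw [hX, if_neg (hc1 d j hj), hg, tsub_add_cancel_of_le (hle (hc1 d j hj)), if_pos hj]
      · intro i _ hij
        rw [hX]
        split_ifs with hi
        · rfl
        · rw [hg, tsub_add_cancel_of_le (hle hi), if_neg]
          rw [hj]; simpa using hij.symm
      · simp
  · rw [hg]
    split_ifs <;> simp

theorem mem_idealSupVars_pow_iff [Finite σ] {k : ℕ} {f : MvPowerSeries σ R} :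
    f ∈ idealSupVars m σ ^ k ↔ ∀ d : σ →₀ ℕ, coeff d f ∈ m ^ (k - d.degree) := by
  cases nonempty_fintype σ
  refine ⟨fun hf d ↦ coeff_mem_of_mem_idealSupVars_pow m k hf d, fun hf ↦ ?_⟩
  induction k generalizing f with
  | zero => simp
  | succ k ih =>
    obtain ⟨g, hfg, hg⟩ := exists_eq_C_add_sum_X_mul f
    rw [hfg]
    refine add_mem ?_ (sum_mem fun i _ ↦ ?_)
    · have h0 : constantCoeff f ∈ m ^ (k + 1) := by simpa using hf 0
      refine Ideal.pow_right_mono (le_sup_left : m.map C ≤ idealSupVars m σ) _ ?_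
      rw [← Ideal.map_pow]
      exact Ideal.mem_map_of_mem _ h0
    · rw [pow_succ']
      refine Ideal.mul_mem_mul (Ideal.mem_sup_right (Ideal.subset_span ⟨i, rfl⟩)) (ih fun d ↦ ?_)
      rcases hg i d with h | h
      · rw [h]
        refine Ideal.pow_le_pow_right ?_ (hf _)
        simp
      · simp [h]

theorem maximalIdeal_eq_idealSupVars [Finite σ] [IsLocalRing R] :
    maximalIdeal (MvPowerSeries σ R) = idealSupVars (maximalIdeal R) σ := by
  ext f
  rw [← pow_one (idealSupVars (maximalIdeal R) σ), mem_idealSupVars_pow_iff, mem_maximalIdeal, mem_nonunits_iff,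
    isUnit_iff_constantCoeff, ← mem_nonunits_iff, ← mem_maximalIdeal]
  refine ⟨fun h d ↦ ?_, fun h ↦ by simpa using h 0⟩
  by_cases hd : d = 0
  · simpa [hd] using h
  · have : d.degree ≠ 0 := by simpa [Finsupp.degree_eq_zero_iff] using hd
    rw [Nat.sub_eq_zero_of_le (by lia)]
    simp

open AdicCompletion

section

variable [Finite σ]

variable {m} in
theorem coeff_sub_mem_of_cauchy (f : AdicCauchySequence (idealSupVars m σ) (MvPowerSeries σ R))
    (d : σ →₀ ℕ) {i j k : ℕ} (hi : k + d.degree ≤ i) (hj : k + d.degree ≤ j) :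
    coeff d (f i) - coeff d (f j) ∈ m ^ k := by
  have key {i j : ℕ} (hi : k + d.degree ≤ i) (hij : i ≤ j) :
      coeff d (f i) - coeff d (f j) ∈ m ^ k := by
    have h := f.2 hij
    rw [SModEq.sub_mem] at h
    simp only [smul_eq_mul, Ideal.mul_top] at h
    have := (mem_idealSupVars_pow_iff m).1 h d
    rw [map_sub] at this
    exact Ideal.pow_le_pow_right (by lia) this
  rcases le_total i j with h | h
  · exact key hi h
  · rw [← neg_sub]
    exact neg_mem (key hj h)

/-- The coefficientwise limit of a Cauchy sequence of power series, as a family of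
Cauchy sequences. -/
noncomputable def cauchyCoeff (f : AdicCauchySequence (idealSupVars m σ) (MvPowerSeries σ R))
    (d : σ →₀ ℕ) : AdicCauchySequence m R :=
  .mk m R (fun k ↦ coeff d (f (k + d.degree))) fun k ↦ by
    rw [SModEq.sub_mem]
    simpa using coeff_sub_mem_of_cauchy f d le_rfl (by lia)

/-- The coefficientwise limit of a Cauchy sequence of power series. -/
noncomputable def cauchyLimit (f : AdicCauchySequence (idealSupVars m σ) (MvPowerSeries σ R)) :
    MvPowerSeries σ (AdicCompletion m R) :=
  fun d ↦ AdicCompletion.mk m R (cauchyCoeff m f d)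

theorem evalₐ_coeff_cauchyLimit
    (f : AdicCauchySequence (idealSupVars m σ) (MvPowerSeries σ R))
    (d : σ →₀ ℕ) {j k : ℕ} (hj : k + d.degree ≤ j) :
    evalₐ m k (coeff d (cauchyLimit m f)) = Ideal.Quotient.mk (m ^ k) (coeff d (f j)) := by
  rw [coeff_apply, cauchyLimit, evalₐ_mk, Ideal.Quotient.eq]
  exact coeff_sub_mem_of_cauchy f d le_rfl hj

/-- `cauchyLimit` as a ring homomorphism. -/
noncomputable def cauchyLimitHom :
    AdicCauchySequence (idealSupVars m σ) (MvPowerSeries σ R) →+*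
      MvPowerSeries σ (AdicCompletion m R) where
  toFun := cauchyLimit m
  map_one' := by
    classical
    ext1 d
    refine ext_evalₐ fun k ↦ ?_
    rw [evalₐ_coeff_cauchyLimit m _ d le_rfl, AdicCompletion.one_apply, coeff_one, coeff_one]
    split_ifs <;> simp
  map_mul' f g := by
    classical
    ext1 d
    refine ext_evalₐ fun k ↦ ?_
    rw [evalₐ_coeff_cauchyLimit m _ d le_rfl, AdicCompletion.mul_apply, coeff_mul, coeff_mul,
      map_sum, map_sum]
    refine Finset.sum_congr rfl fun p hp ↦ ?_
    have : d.degree = p.1.degree + p.2.degree := by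
      rw [← Finset.HasAntidiagonal.mem_antidiagonal.1 hp, map_add]
    rw [map_mul, map_mul, evalₐ_coeff_cauchyLimit m f p.1 (j := k + d.degree) (by lia),
      evalₐ_coeff_cauchyLimit m g p.2 (j := k + d.degree) (by lia)]
  map_zero' := by
    ext1 d
    refine ext_evalₐ fun k ↦ ?_
    rw [evalₐ_coeff_cauchyLimit m _ d le_rfl, AdicCauchySequence.zero_apply]
    simp
  map_add' f g := by
    ext1 d
    refine ext_evalₐ fun k ↦ ?_
    rw [evalₐ_coeff_cauchyLimit m _ d le_rfl, AdicCauchySequence.add_apply]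
    simp only [map_add, evalₐ_coeff_cauchyLimit m _ d (le_refl (k + d.degree))]

theorem cauchyLimitHom_surjective : Function.Surjective (cauchyLimitHom (σ := σ) m) := by
  intro t
  choose r hr using fun (d : σ →₀ ℕ) (k : ℕ) ↦
    Ideal.Quotient.mk_surjective (evalₐ m k (coeff d t))
  have hcauchy (d : σ →₀ ℕ) {k l : ℕ} (h : k ≤ l) : r d k - r d l ∈ m ^ k := by
    obtain ⟨g, hg⟩ := AdicCompletion.mk_surjective m R (coeff d t)
    have hr' (k : ℕ) : r d k - g k ∈ m ^ k := by
      rw [← Ideal.Quotient.eq, hr, ← hg, evalₐ_mk]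
    have hgl : g k - g l ∈ m ^ k := by
      have := g.2 h
      rw [SModEq.sub_mem] at this
      simpa using this
    have := sub_mem (add_mem (hr' k) hgl) (Ideal.pow_le_pow_right h (hr' l))
    ring_nf at this ⊢
    exact this
  choose p hp using fun j ↦ (⟨fun d ↦ r d (j - d.degree), fun _ ↦ rfl⟩ :
    ∃ p : MvPowerSeries σ R, ∀ d, coeff d p = r d (j - d.degree))
  refine ⟨.mk _ _ p fun j ↦ ?_, ?_⟩
  · rw [SModEq.sub_mem]
    simp only [smul_eq_mul, Ideal.mul_top]
    rw [mem_idealSupVars_pow_iff]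
    intro d
    rw [map_sub, hp, hp]
    exact hcauchy d (by lia)
  · ext1 d
    refine ext_evalₐ fun k ↦ (evalₐ_coeff_cauchyLimit m _ d le_rfl).trans ?_
    rw [← hr d k]
    exact congrArg _ ((hp _ d).trans (by simp))

theorem ker_cauchyLimitHom :
    RingHom.ker (cauchyLimitHom (σ := σ) m) =
      RingHom.ker (AdicCompletion.mkₐ (idealSupVars m σ)).toRingHom := by
  ext f
  rw [RingHom.mem_ker, RingHom.mem_ker]
  have h1 : cauchyLimitHom m f = 0 ↔ ∀ d k, coeff d (f (k + d.degree)) ∈ m ^ k := by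
    simp_rw [← Ideal.Quotient.eq_zero_iff_mem, ← evalₐ_coeff_cauchyLimit m f _ le_rfl]
    refine ⟨fun h d k ↦ ?_, fun h ↦ ?_⟩
    · have h' : cauchyLimit m f = 0 := h
      simp [h']
    · ext1 d
      refine ext_evalₐ fun k ↦ (h d k).trans (by simp)
  have h2 : (AdicCompletion.mkₐ (idealSupVars m σ)).toRingHom f = 0 ↔
      ∀ j, f j ∈ idealSupVars m σ ^ j := by
    simp_rw [← Ideal.Quotient.eq_zero_iff_mem]
    refine ⟨fun h j ↦ ?_, fun h ↦ ext_evalₐ fun j ↦ ?_⟩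
    · have := congrArg (evalₐ _ j) h
      rw [_root_.map_zero] at this
      exact (evalₐ_mk _ j f).symm.trans this
    · rw [_root_.map_zero]
      exact (evalₐ_mk _ j f).trans (h j)
  rw [h1, h2]
  refine ⟨fun h j ↦ (mem_idealSupVars_pow_iff m).2 fun d ↦ ?_, fun h d k ↦ ?_⟩
  · by_cases hd : d.degree ≤ j
    · simpa [Nat.sub_add_cancel hd] using h d (j - d.degree)
    · rw [Nat.sub_eq_zero_of_le (by lia)]
      simp
  · simpa using (mem_idealSupVars_pow_iff m).1 (h (k + d.degree)) d

theorem cauchyLimitHom_algebraMap (s : MvPowerSeries σ R) :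
    cauchyLimitHom m (algebraMap _ _ s) = map (algebraMap R (AdicCompletion m R)) s := by
  ext1 d
  refine ext_evalₐ fun k ↦ (evalₐ_coeff_cauchyLimit m _ d le_rfl).trans ?_
  rw [coeff_map, AlgHom.commutes]
  rfl

theorem exists_ringEquiv_adicCompletion :
    ∃ e : AdicCompletion (idealSupVars m σ) (MvPowerSeries σ R) ≃+*
        MvPowerSeries σ (AdicCompletion m R),
      ∀ s, e (algebraMap _ _ s) = map (algebraMap R (AdicCompletion m R)) s := by
  have hmk : Function.Surjective (AdicCompletion.mkₐ (idealSupVars m σ)).toRingHom :=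
    AdicCompletion.mk_surjective _ _
  let e₁ := RingHom.quotientKerEquivOfSurjective hmk
  let e₂ := RingHom.quotientKerEquivOfSurjective (cauchyLimitHom_surjective (σ := σ) m)
  refine ⟨(e₁.symm.trans (Ideal.quotEquivOfEq (ker_cauchyLimitHom m).symm)).trans e₂,
    fun s ↦ ?_⟩
  have hs : e₁.symm (algebraMap _ _ s) = Ideal.Quotient.mk _ (algebraMap _ _ s) := by
    rw [RingEquiv.symm_apply_eq]
    rfl
  rw [RingEquiv.trans_apply, RingEquiv.trans_apply, hs, Ideal.quotEquivOfEq_mk]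
  exact cauchyLimitHom_algebraMap m s

end

end MvPowerSeries

namespace AdicCompletion

variable {S : Type u} [CommRing S] (M J : Ideal S)

theorem mem_pow_smul_top_quotient_iff (n : ℕ) (a : S ⧸ J) :
    a ∈ (M ^ n • ⊤ : Submodule S (S ⧸ J)) ↔ a ∈ M.map (Ideal.Quotient.mk J) ^ n := by
  rw [Ideal.smul_top_eq_map, Submodule.restrictScalars_mem, Ideal.map_pow]
  rfl

/-- The ring homomorphism on completions induced by `S → S ⧸ J`. -/
noncomputable def quotientMap :
    AdicCompletion M S →+* AdicCompletion (M.map (Ideal.Quotient.mk J)) (S ⧸ J) :=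
  liftRingHom _
    (fun n ↦ (Ideal.quotientMap (I := M ^ n) (M.map (Ideal.Quotient.mk J) ^ n)
      (Ideal.Quotient.mk J)
        (by rw [← Ideal.map_pow]; exact Ideal.le_comap_map)).comp
          (evalₐ M n : AdicCompletion M S →+* S ⧸ M ^ n))
    (by
      intro m n hmn
      ext x
      obtain ⟨f, rfl⟩ := mk_surjective M S x
      have h := congrArg (Ideal.quotientMap (I := M ^ m) (M.map (Ideal.Quotient.mk J) ^ m)
        (Ideal.Quotient.mk J) (by rw [← Ideal.map_pow]; exact Ideal.le_comap_map))
        (AdicCompletion.Ideal.mk_eq_mk M hmn f)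
      simpa using! h)

theorem evalₐ_quotientMap_mk (f : AdicCauchySequence M S) (n : ℕ) :
    evalₐ _ n (quotientMap M J (mk M S f)) =
      Ideal.Quotient.mk _ (Ideal.Quotient.mk J (f n)) :=
  rfl

theorem quotientMap_surjective : Function.Surjective (quotientMap M J) := by
  intro a
  obtain ⟨g, rfl⟩ := mk_surjective _ _ a
  let g' : AdicCauchySequence M (S ⧸ J) := ⟨g.1, fun {m n} hmn ↦ by
    have h := g.2 hmn
    rw [SModEq.sub_mem] at h ⊢
    rw [mem_pow_smul_top_quotient_iff]
    simpa using h⟩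
  obtain ⟨x, hx⟩ := map_surjective M (Submodule.mkQ_surjective J) (mk M _ g')
  obtain ⟨f, rfl⟩ := mk_surjective M S x
  refine ⟨mk M S f, ext_evalₐ fun n ↦ ?_⟩
  have h := congrArg (fun z ↦ z.val n) hx
  rw [evalₐ_quotientMap_mk, evalₐ_mk, Ideal.Quotient.eq, ← mem_pow_smul_top_quotient_iff]
  exact (Submodule.Quotient.eq _).1 h

theorem ker_quotientMap [IsNoetherianRing S] :
    RingHom.ker (quotientMap M J) = J.map (algebraMap S (AdicCompletion M S)) := by
  apply le_antisymm
  · intro x hx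
    have hx0 : map M (Submodule.mkQ J) x = 0 := by
      obtain ⟨f, rfl⟩ := mk_surjective M S x
      ext n
      have h := congrArg (evalₐ _ n) (RingHom.mem_ker.1 hx)
      rw [evalₐ_quotientMap_mk, _root_.map_zero, Ideal.Quotient.eq_zero_iff_mem,
        ← mem_pow_smul_top_quotient_iff] at h
      exact (Submodule.Quotient.mk_eq_zero _).2 h
    have hex : Function.Exact J.subtype J.mkQ := LinearMap.exact_subtype_mkQ J
    obtain ⟨y, rfl⟩ := (map_exact (I := M) J.subtype_injective hex J.mkQ_surjective x).1 hx0
    obtain ⟨z, rfl⟩ := ofTensorProduct_surjective_of_finite M J y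
    clear hx hx0
    induction z with
    | zero => simp
    | add a b ha hb =>
      rw [_root_.map_add, _root_.map_add]
      exact add_mem ha hb
    | tmul r j =>
      rw [ofTensorProduct_tmul, map_smul, map_of]
      exact Ideal.mul_mem_left _ r (Ideal.mem_map_of_mem _ j.2)
  · rw [Ideal.map_le_iff_le_comap]
    intro j hj
    rw [Ideal.mem_comap, RingHom.mem_ker]
    refine ext_evalₐ fun n ↦ ?_
    trans Ideal.Quotient.mk _ (Ideal.Quotient.mk J j)
    · exact evalₐ_quotientMap_mk M J (algebraMap S _ j) n
    · rw [Ideal.Quotient.eq_zero_iff_mem.2 hj, _root_.map_zero, _root_.map_zero]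

end AdicCompletion

theorem IsLocalRing.maximalIdeal_quotient_eq_map {S : Type*} [CommRing S] [IsLocalRing S]
    (J : Ideal S) [IsLocalRing (S ⧸ J)] :
    maximalIdeal (S ⧸ J) = (maximalIdeal S).map (Ideal.Quotient.mk J) := by
  have := Ideal.comap_isMaximal_of_surjective (K := maximalIdeal (S ⧸ J)) _
    (Ideal.Quotient.mk_surjective (I := J))
  rw [← eq_maximalIdeal this,
    Ideal.map_comap_of_surjective _ Ideal.Quotient.mk_surjective]

theorem statement7
    (R : Type u) [CommRing R] [IsNoetherianRing R] [IsLocalRing R] [Algebra ℚ R]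
    (n : ℕ) (I : Ideal (MvPowerSeries (Fin n) ℚ))
    [IsLocalRing (MvPowerSeries (Fin n) R ⧸ I.psExt n R)] :
    Nonempty
      (AdicCompletion
          (maximalIdeal (MvPowerSeries (Fin n) R ⧸ I.psExt n R))
          (MvPowerSeries (Fin n) R ⧸ I.psExt n R) ≃+*
        (MvPowerSeries (Fin n) (AdicCompletion (maximalIdeal R) R) ⧸
          I.map (MvPowerSeries.map (σ := Fin n)
            ((algebraMap R (AdicCompletion (maximalIdeal R) R)).comp
              (algebraMap ℚ R))))) := by
  let J := I.psExt n R
  let M := MvPowerSeries.idealSupVars (maximalIdeal R) (Fin n)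
  have hM : maximalIdeal (MvPowerSeries (Fin n) R ⧸ J) = M.map (Ideal.Quotient.mk J) := by
    rw [IsLocalRing.maximalIdeal_quotient_eq_map, MvPowerSeries.maximalIdeal_eq_idealSupVars]
  obtain ⟨e, he⟩ := MvPowerSeries.exists_ringEquiv_adicCompletion (σ := Fin n) (maximalIdeal R)
  have hJ : I.map (MvPowerSeries.map (σ := Fin n)
      ((algebraMap R (AdicCompletion (maximalIdeal R) R)).comp (algebraMap ℚ R))) =
      (RingHom.ker (AdicCompletion.quotientMap M J)).map e.toRingHom := by
    have hcomp : e.toRingHom.comp (algebraMap (MvPowerSeries (Fin n) R) (AdicCompletion M _)) =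
        MvPowerSeries.map (algebraMap R (AdicCompletion (maximalIdeal R) R)) :=
      RingHom.ext he
    rw [AdicCompletion.ker_quotientMap, Ideal.map_map, hcomp, MvPowerSeries.map_comp]
    exact (Ideal.map_map _ _).symm
  rw [hM]
  exact ⟨(RingHom.quotientKerEquivOfSurjective
    (AdicCompletion.quotientMap_surjective M J)).symm.trans (Ideal.quotientEquiv _ _ e hJ)⟩
end

section
/- Assume setting (†). Let (T, M) be a local ring containing the rationals, let Q₁, Q₂ ∈ Spec(T) with Q₁ ⊄ Q₂ and Q₂ ⊄ Q₁, let T̄ = T/(Q₁ ∩ Q₂), and let Q̄ᵢᵉ = (Qᵢ/(Q₁ ∩ Q₂))·T̄[[y₁, …, yₙ]] for i = 1, 2. If J is a prime ideal of T̄[[y₁, …, yₙ]] with I·T̄[[y₁, …, yₙ]] ⊆ J, then there exists ℓ ∈ {1, …, k} such that 𝔮_ℓ·T̄[[y₁, …, yₙ]] ⊆ J, and moreover Q̄₁ᵉ ⊆ J or Q̄₂ᵉ ⊆ J. -/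
/-!
Setting (†): `y₁, …, yₙ` are indeterminates, `I` is a proper ideal of `ℚ[[y₁, …, yₙ]]`
with minimal primes `𝔮₁, …, 𝔮ₖ`, and for every integral domain `D` containing `ℚ` the
extensions `𝔮ᵢ·D[[y₁, …, yₙ]]` are prime and pairwise incomparable.

We model `A[[y₁, …, yₙ]]` as `MvPowerSeries (Fin n) A`.  A "local ring" is a
commutative Noetherian ring with exactly one maximal ideal.
-/

universe u

theorem statement11
    -- Setting (†)
    (n k : ℕ) (I : Ideal (MvPowerSeries (Fin n) ℚ)) (hI : I ≠ ⊤)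
    (q : Fin k → Ideal (MvPowerSeries (Fin n) ℚ)) (hqinj : Function.Injective q)
    (hqmin : I.minimalPrimes = Set.range q)
    (hqprime : ∀ (D : Type u) [CommRing D] [IsDomain D] [Algebra ℚ D] (i : Fin k),
      ((q i).psExt n D).IsPrime)
    (hqincomp : ∀ (D : Type u) [CommRing D] [IsDomain D] [Algebra ℚ D] (i j : Fin k),
      (q i).psExt n D ≤ (q j).psExt n D ↔ i = j)
    -- the local ring `T` and the primes `Q₁`, `Q₂`
    (T : Type u) [CommRing T] [IsNoetherianRing T] [IsLocalRing T] [Algebra ℚ T]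
    (Q₁ Q₂ : Ideal T) [Q₁.IsPrime] [Q₂.IsPrime]
    (h12 : ¬Q₁ ≤ Q₂) (h21 : ¬Q₂ ≤ Q₁)
    -- `J`: a prime ideal of `T̄[[y₁, …, yₙ]]` containing `I·T̄[[y₁, …, yₙ]]`, where
    -- `T̄ = T/(Q₁ ∩ Q₂)`
    (J : Ideal (MvPowerSeries (Fin n) (T ⧸ (Q₁ ⊓ Q₂)))) (hJ : J.IsPrime)
    (hIJ : I.psExt n (T ⧸ (Q₁ ⊓ Q₂)) ≤ J) :
    -- some `𝔮_ℓ·T̄[[y₁, …, yₙ]]` is contained in `J`, and `Q̄₁ᵉ ⊆ J` or `Q̄₂ᵉ ⊆ J`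
    (∃ ℓ : Fin k, (q ℓ).psExt n (T ⧸ (Q₁ ⊓ Q₂)) ≤ J) ∧
    ((Q₁.map (Ideal.Quotient.mk (Q₁ ⊓ Q₂))).constExt n ≤ J ∨
      (Q₂.map (Ideal.Quotient.mk (Q₁ ⊓ Q₂))).constExt n ≤ J) := by
  constructor
  · have := hJ
    obtain ⟨p, hp, hpJ⟩ := Ideal.exists_minimalPrimes_le
      (J := J.comap (MvPowerSeries.map (σ := Fin n) (algebraMap ℚ (T ⧸ (Q₁ ⊓ Q₂)))))
      (Ideal.map_le_iff_le_comap.mp hIJ)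
    rw [hqmin] at hp
    obtain ⟨ℓ, rfl⟩ := hp
    exact ⟨ℓ, Ideal.map_le_iff_le_comap.mpr hpJ⟩
  · have hmul : (Q₁ * Q₂).map (Ideal.Quotient.mk (Q₁ ⊓ Q₂)) = ⊥ :=
      (Ideal.map_eq_bot_iff_le_ker _).mpr (by rw [Ideal.mk_ker]; exact Ideal.mul_le_inf)
    refine hJ.mul_le.mp ?_
    simp only [Ideal.constExt]
    rw [← Ideal.map_mul, ← Ideal.map_mul, hmul, Ideal.map_bot]
    exact bot_le
end
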